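/- arXiv:2208.09781 — 19 statements merged into one kernel-verified Lean document; each statement's English description precedes it below -/
import Mathlib

section
/- Suppose g < f(π⁺). Then the bundle d* with d*_k = f_k(π⁺) for every k maximizes S(d) := U(d) − P(Σ_k d_k − g) over D (net-consumption zone). Suppose instead g > f(π⁻). Then the bundle d* with d*_k = f_k(π⁻) for every k maximizes S over D (net-production zone). Finally, if f(π⁺) ≤ g ≤ f(π⁻), then any maximizer d* of U(d) over D subject to the constraint Σ_k d_k = g also maximizes S over D, and it satisfies Σ_k d*_k − g = 0 (net-zero zone). -/
open Set

/-- If each `p k` maximizes `U k x - π * x` over `C k`, so does `p` for the sums over the product. -/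
theorem sum_sub_mul_sum_le_of_forall_le {ι : Type*} [Fintype ι] {C : ι → Set ℝ}
    {U : ι → ℝ → ℝ} {π : ℝ} {p d : ι → ℝ}
    (hmax : ∀ k, ∀ x ∈ C k, U k x - π * x ≤ U k (p k) - π * p k) (hd : ∀ k, d k ∈ C k) :
    (∑ k, U k (d k)) - π * ∑ k, d k ≤ (∑ k, U k (p k)) - π * ∑ k, p k := by
  simpa only [Finset.mul_sum, ← Finset.sum_sub_distrib] using
    Finset.sum_le_sum fun k _ => hmax k (d k) (hd k)

/-- A bundle whose total lies on the other side of `g` from that of a maximizer at price `π` can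
be replaced by one with total exactly `g`, without loss of surplus at price `π`. -/
theorem exists_sum_eq_and_surplus_le {ι : Type*} [Fintype ι] {C : ι → Set ℝ}
    {U : ι → ℝ → ℝ} {π g : ℝ} {p d : ι → ℝ} (hconc : ∀ k, ConcaveOn ℝ (C k) (U k))
    (hp : ∀ k, p k ∈ C k)
    (hmax : ∀ k, ∀ x ∈ C k, U k x - π * x ≤ U k (p k) - π * p k)
    (hd : ∀ k, d k ∈ C k) (hg : g ∈ segment ℝ (∑ k, p k) (∑ k, d k)) :
    ∃ e : ι → ℝ, (∀ k, e k ∈ C k) ∧ (∑ k, e k) = g ∧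
      (∑ k, U k (d k)) - π * ((∑ k, d k) - g) ≤ ∑ k, U k (e k) := by
  obtain ⟨a, b, ha, hb, hab, hg⟩ := hg
  refine ⟨fun k => a • p k + b • d k, fun k => (hconc k).1 (hp k) (hd k) ha hb hab, ?_, ?_⟩
  · rw [← hg, Finset.sum_add_distrib, Finset.smul_sum, Finset.smul_sum]
  · have hU : a * (∑ k, U k (p k)) + b * (∑ k, U k (d k)) ≤
        ∑ k, U k (a • p k + b • d k) := by
      rw [Finset.mul_sum, Finset.mul_sum, ← Finset.sum_add_distrib]
      exact Finset.sum_le_sum fun k _ => (hconc k).2 (hp k) (hd k) ha hb hab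
    have hL := mul_le_mul_of_nonneg_left (sum_sub_mul_sum_le_of_forall_le hmax hd) ha
    refine le_trans (le_of_sub_nonneg ?_) hU
    obtain rfl : b = 1 - a := by linarith
    simp only [smul_eq_mul] at hg
    rw [← hg]
    linarith

/-- Theorem (prosumer consumption decision under NEM X, no storage):
two-threshold three-zone structure of the optimal consumption. -/
theorem prosumer_no_storage_three_zones
    (K : ℕ) (hK : 0 < K)
    (dbar : Fin K → ℝ) (hdbar : ∀ k, 0 < dbar k)
    (U : Fin K → ℝ → ℝ)
    (hconc : ∀ k, StrictConcaveOn ℝ (Icc 0 (dbar k)) (U k))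
    (hmono : ∀ k, MonotoneOn (U k) (Icc 0 (dbar k)))
    (hC1 : ∀ k, ContDiffOn ℝ 1 (U k) (Icc 0 (dbar k)))
    -- `f k π` is the unique maximizer of `x ↦ U k x − π x` over `[0, dbar k]`
    (f : Fin K → ℝ → ℝ)
    (hf : ∀ k, ∀ π : ℝ, 0 ≤ π → f k π ∈ Icc 0 (dbar k) ∧
      (∀ x ∈ Icc 0 (dbar k), x ≠ f k π → U k x - π * x < U k (f k π) - π * f k π))
    -- NEM X rates
    (pim pip : ℝ) (hpim : 0 ≤ pim) (hpi : pim ≤ pip)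
    (P : ℝ → ℝ) (hP : ∀ z, P z = pip * max z 0 + pim * min z 0)
    -- renewable generation
    (g : ℝ) (hg : 0 ≤ g)
    -- consumption set and surplus
    (D : Set (Fin K → ℝ)) (hD : D = univ.pi fun k => Icc 0 (dbar k))
    (S : (Fin K → ℝ) → ℝ)
    (hS : ∀ d, S d = (∑ k, U k (d k)) - P ((∑ k, d k) - g)) :
    -- net-consumption zone
    (g < (∑ k, f k pip) → IsMaxOn S D (fun k => f k pip)) ∧
    -- net-production zone
    (g > (∑ k, f k pim) → IsMaxOn S D (fun k => f k pim)) ∧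
    -- net-zero zone
    ((∑ k, f k pip) ≤ g ∧ g ≤ (∑ k, f k pim) →
      ∀ dstar ∈ D, (∑ k, dstar k) = g →
        (∀ d ∈ D, (∑ k, d k) = g → (∑ k, U k (d k)) ≤ (∑ k, U k (dstar k))) →
        IsMaxOn S D dstar ∧ (∑ k, dstar k) - g = 0) := by
  have hmax : ∀ π, 0 ≤ π → ∀ k, ∀ x ∈ Icc 0 (dbar k),
      U k x - π * x ≤ U k (f k π) - π * f k π := by
    intro π hπ k x hx
    rcases eq_or_ne x (f k π) with rfl | hne
    · exact le_rfl
    · exact ((hf k π hπ).2 x hx hne).le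
  have hpip : 0 ≤ pip := hpim.trans hpi
  have hPpos : ∀ z, 0 ≤ z → P z = pip * z := fun z hz => by simp [hP, hz]
  have hPneg : ∀ z, z ≤ 0 → P z = pim * z := fun z hz => by simp [hP, hz]
  have hPip : ∀ z, pip * z ≤ P z := by
    intro z
    rcases le_total 0 z with hz | hz
    · exact (hPpos z hz).ge
    · exact hPneg z hz ▸ mul_le_mul_of_nonpos_right hpi hz
  have hPim : ∀ z, pim * z ≤ P z := by
    intro z
    rcases le_total 0 z with hz | hz
    · exact hPpos z hz ▸ mul_le_mul_of_nonneg_right hpi hz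
    · exact (hPneg z hz).ge
  have hmem : ∀ {d}, d ∈ D ↔ ∀ k, d k ∈ Icc 0 (dbar k) := by
    intro d
    rw [hD, mem_univ_pi]
  refine ⟨fun h => isMaxOn_iff.2 fun d hd => ?_, fun h => isMaxOn_iff.2 fun d hd => ?_,
    fun ⟨hlo, hhi⟩ dstar _ hsum hopt =>
      ⟨isMaxOn_iff.2 fun d hd => ?_, sub_eq_zero.2 hsum⟩⟩
  · rw [hS, hS, hPpos ((∑ k, f k pip) - g) (by linarith)]
    have := sum_sub_mul_sum_le_of_forall_le (hmax pip hpip) (hmem.1 hd)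
    linarith [hPip ((∑ k, d k) - g)]
  · rw [hS, hS, hPneg ((∑ k, f k pim) - g) (by linarith)]
    have := sum_sub_mul_sum_le_of_forall_le (hmax pim hpim) (hmem.1 hd)
    linarith [hPim ((∑ k, d k) - g)]
  · rw [hS, hS, hsum, sub_self, hPpos 0 le_rfl, mul_zero, sub_zero]
    have hconc' := fun k => (hconc k).concaveOn
    rcases le_total g (∑ k, d k) with hdg | hdg
    · obtain ⟨e, he, hesum, hle⟩ := exists_sum_eq_and_surplus_le hconc'
        (fun k => (hf k pip hpip).1) (hmax pip hpip) (hmem.1 hd)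
        (by rw [segment_eq_uIcc]; exact mem_uIcc.2 (Or.inl ⟨hlo, hdg⟩))
      rw [hPpos _ (sub_nonneg.2 hdg)]
      exact hle.trans (hopt e (hmem.2 he) hesum)
    · obtain ⟨e, he, hesum, hle⟩ := exists_sum_eq_and_surplus_le hconc'
        (fun k => (hf k pim hpim).1) (hmax pim hpim) (hmem.1 hd)
        (by rw [segment_eq_uIcc]; exact mem_uIcc.2 (Or.inr ⟨hdg, hhi⟩))
      rw [hPneg _ (sub_nonpos.2 hdg)]
      exact hle.trans (hopt e (hmem.2 he) hesum)
end

section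
/- For every stage t = 0,…,T, every state (s,g) with s ≥ 0, g ≥ 0, and every ε > 0, the value function satisfies V_t(s+ε, g) ≥ V_t(s, g) + γ·ε; in particular, if γ > 0 then V_t is strictly increasing in the storage state s. -/
open Set MeasureTheory ProbabilityTheory

theorem value_function_monotone_in_storage
    (T K : ℕ) (hK : 0 < K)
    (dbar : ℕ → Fin K → ℝ) (hdbar : ∀ t k, 0 < dbar t k)
    (U : ℕ → Fin K → ℝ → ℝ)
    (hconc : ∀ t k, StrictConcaveOn ℝ (Icc 0 (dbar t k)) (U t k))
    (hmono : ∀ t k, MonotoneOn (U t k) (Icc 0 (dbar t k)))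
    (hC1 : ∀ t k, ContDiffOn ℝ 1 (U t k) (Icc 0 (dbar t k)))
    -- NEM X rates and payment functions
    (pim pip : ℕ → ℝ) (hpim : ∀ t, 0 ≤ pim t) (hpi : ∀ t, pim t ≤ pip t)
    (P : ℕ → ℝ → ℝ) (hP : ∀ t z, P t z = pip t * max z 0 + pim t * min z 0)
    -- storage parameters
    (elow ebar : ℝ) (helow : 0 ≤ elow) (hebar : 0 ≤ ebar)
    (tau rho : ℝ) (htau : tau ∈ Ioc (0:ℝ) 1) (hrho : rho ∈ Ioc (0:ℝ) 1)
    (gam : ℝ) (hgam : 0 ≤ gam)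
    -- feasible action set (state independent)
    (A : ℕ → Set ((Fin K → ℝ) × ℝ))
    (hA : ∀ t, A t = (univ.pi fun k => Icc 0 (dbar t k)) ×ˢ Icc (-elow) ebar)
    -- Markov transition kernels of the renewable process
    (κ : ℕ → Kernel ℝ ℝ) (hκ : ∀ t, IsMarkovKernel (κ t))
    -- value functions, their measurability and integrability
    (V : ℕ → ℝ → ℝ → ℝ)
    (hVmeas : ∀ t s, Measurable (V t s))
    (hVint : ∀ t t' s g, Integrable (V t s) (κ t' g))
    -- terminal value
    (hVT : ∀ s g, V T s g = gam * s)
    -- Bellman objective and backward induction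
    (Φ : ℕ → ℝ → ℝ → (Fin K → ℝ) × ℝ → ℝ)
    (hΦ : ∀ t s g u, Φ t s g u =
      (∑ k, U t k (u.1 k)) - P t ((∑ k, u.1 k) + u.2 - g)
        + ∫ g', V (t + 1) (s + tau * max u.2 0 - max (-u.2) 0 / rho) g' ∂(κ t g))
    (hbdd : ∀ t < T, ∀ s g, BddAbove (Φ t s g '' A t))
    (hBellman : ∀ t < T, ∀ s g, V t s g = sSup (Φ t s g '' A t))
    :
    (∀ t ≤ T, ∀ s g : ℝ, 0 ≤ s → 0 ≤ g → ∀ ε > 0, V t s g + gam * ε ≤ V t (s + ε) g) ∧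
    (0 < gam → ∀ t ≤ T, ∀ g : ℝ, 0 ≤ g → StrictMonoOn (fun s => V t s g) (Ici 0)) := by
  have key : ∀ t ≤ T, ∀ s g ε : ℝ, 0 < ε → V t s g + gam * ε ≤ V t (s + ε) g := by
    intro t ht
    induction ht using Nat.decreasingInduction with
    | self => intro s g ε _; rw [hVT, hVT, mul_add]
    | of_succ t ht ih =>
      intro s g ε hε
      have hne : (Φ t s g '' A t).Nonempty := by
        refine Set.Nonempty.image _ ⟨(0, 0), ?_⟩
        rw [hA]
        exact ⟨fun k _ => ⟨le_rfl, (hdbar t k).le⟩, neg_nonpos.2 helow, hebar⟩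
      rw [hBellman t ht, hBellman t ht, ← le_sub_iff_add_le]
      refine csSup_le hne ?_
      rintro _ ⟨u, hu, rfl⟩
      rw [le_sub_iff_add_le]
      refine le_trans ?_ (le_csSup (hbdd t ht (s + ε) g) (mem_image_of_mem _ hu))
      rw [hΦ, hΦ, add_assoc]
      gcongr
      have := hκ t
      set x := s + tau * max u.2 0 - max (-u.2) 0 / rho with hx
      have hx' : s + ε + tau * max u.2 0 - max (-u.2) 0 / rho = x + ε := by rw [hx]; ring
      rw [hx']
      calc (∫ g', V (t + 1) x g' ∂(κ t g)) + gam * ε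
          = ∫ g', (V (t + 1) x g' + gam * ε) ∂(κ t g) := by
            rw [integral_add (hVint _ _ _ _) (integrable_const _)]; simp
        _ ≤ _ := integral_mono ((hVint _ _ _ _).add (integrable_const _)) (hVint _ _ _ _)
            fun g' => ih x g' ε hε
  refine ⟨fun t ht s g _ _ ε hε => key t ht s g ε hε, fun hgam' t ht g _ a _ b _ hab => ?_⟩
  have h := key t ht a g (b - a) (sub_pos.2 hab)
  rw [add_sub_cancel] at h
  exact lt_of_lt_of_le (lt_add_of_pos_right _ (mul_pos hgam' (sub_pos.2 hab))) h
end

section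
/- Assume additionally that each transition kernel κ_t is stochastically monotone, i.e., g ↦ κ_t(g, ·) is nondecreasing in the usual stochastic order. Then for every stage t = 0,…,T, every state (s,g) with s ≥ 0, g ≥ 0, and every ε > 0, the value function satisfies V_t(s, g+ε) ≥ V_t(s, g) + π_t⁻·ε (with the convention π_T⁻ := 0); in particular every V_t is nondecreasing in g, and strictly increasing in g at stages t < T with π_t⁻ > 0. -/
open Set MeasureTheory ProbabilityTheory

/-- A piecewise linear tariff whose slopes are both at least `a` drops by at least `a * ε`
when its argument drops by `ε`. -/
theorem piecewise_linear_sub_le {a b z ε : ℝ} (hab : a ≤ b) (hε : 0 ≤ ε) :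
    b * max (z - ε) 0 + a * min (z - ε) 0 + a * ε ≤ b * max z 0 + a * min z 0 := by
  have hz : max z 0 + min z 0 = z := by simp
  have hw : max (z - ε) 0 + min (z - ε) 0 = z - ε := by simp
  have hmax : max (z - ε) 0 ≤ max z 0 := max_le_max_right 0 (by linarith)
  have h := mul_le_mul_of_nonneg_left hmax (sub_nonneg.2 hab)
  linear_combination h + a * hw - a * hz

theorem value_function_monotone_in_renewable
    (T K : ℕ) (hK : 0 < K)
    (dbar : ℕ → Fin K → ℝ) (hdbar : ∀ t k, 0 < dbar t k)
    (U : ℕ → Fin K → ℝ → ℝ)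
    (hconc : ∀ t k, StrictConcaveOn ℝ (Icc 0 (dbar t k)) (U t k))
    (hmono : ∀ t k, MonotoneOn (U t k) (Icc 0 (dbar t k)))
    (hC1 : ∀ t k, ContDiffOn ℝ 1 (U t k) (Icc 0 (dbar t k)))
    -- NEM X rates and payment functions
    (pim pip : ℕ → ℝ) (hpim : ∀ t, 0 ≤ pim t) (hpi : ∀ t, pim t ≤ pip t)
    (P : ℕ → ℝ → ℝ) (hP : ∀ t z, P t z = pip t * max z 0 + pim t * min z 0)
    -- storage parameters
    (elow ebar : ℝ) (helow : 0 ≤ elow) (hebar : 0 ≤ ebar)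
    (tau rho : ℝ) (htau : tau ∈ Ioc (0:ℝ) 1) (hrho : rho ∈ Ioc (0:ℝ) 1)
    (gam : ℝ) (hgam : 0 ≤ gam)
    -- feasible action set (state independent)
    (A : ℕ → Set ((Fin K → ℝ) × ℝ))
    (hA : ∀ t, A t = (univ.pi fun k => Icc 0 (dbar t k)) ×ˢ Icc (-elow) ebar)
    -- Markov transition kernels of the renewable process
    (κ : ℕ → Kernel ℝ ℝ) (hκ : ∀ t, IsMarkovKernel (κ t))
    -- value functions, their measurability and integrability
    (V : ℕ → ℝ → ℝ → ℝ)
    (hVmeas : ∀ t s, Measurable (V t s))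
    (hVint : ∀ t t' s g, Integrable (V t s) (κ t' g))
    -- terminal value
    (hVT : ∀ s g, V T s g = gam * s)
    -- Bellman objective and backward induction
    (Φ : ℕ → ℝ → ℝ → (Fin K → ℝ) × ℝ → ℝ)
    (hΦ : ∀ t s g u, Φ t s g u =
      (∑ k, U t k (u.1 k)) - P t ((∑ k, u.1 k) + u.2 - g)
        + ∫ g', V (t + 1) (s + tau * max u.2 0 - max (-u.2) 0 / rho) g' ∂(κ t g))
    (hbdd : ∀ t < T, ∀ s g, BddAbove (Φ t s g '' A t))
    (hBellman : ∀ t < T, ∀ s g, V t s g = sSup (Φ t s g '' A t))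
    -- stochastic monotonicity of the kernels (usual stochastic order)
    (hstoch : ∀ t, ∀ g₁ g₂ : ℝ, g₁ ≤ g₂ → ∀ F : ℝ → ℝ, Monotone F →
      Integrable F (κ t g₁) → Integrable F (κ t g₂) →
      (∫ x, F x ∂(κ t g₁)) ≤ ∫ x, F x ∂(κ t g₂)) :
    (∀ t ≤ T, ∀ s g : ℝ, 0 ≤ s → 0 ≤ g → ∀ ε > 0,
      V t s g + (if t = T then 0 else pim t) * ε ≤ V t s (g + ε)) ∧
    (∀ t ≤ T, ∀ s : ℝ, 0 ≤ s → MonotoneOn (fun g => V t s g) (Ici 0)) ∧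
    (∀ t < T, 0 < pim t → ∀ s : ℝ, 0 ≤ s → StrictMonoOn (fun g => V t s g) (Ici 0)) := by
  have hne : ∀ t, (A t).Nonempty := fun t => by
    rw [hA]
    exact ⟨(0, 0), fun k _ => ⟨le_rfl, (hdbar t k).le⟩, by simpa using helow, hebar⟩
  have step : ∀ t < T, (∀ s, Monotone (V (t + 1) s)) → ∀ s g ε, 0 ≤ ε →
      V t s g + pim t * ε ≤ V t s (g + ε) := by
    intro t ht hV s g ε hε
    rw [← le_sub_iff_add_le, hBellman t ht s g]
    refine csSup_le ((hne t).image _) ?_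
    rintro _ ⟨u, hu, rfl⟩
    have hle : Φ t s (g + ε) u ≤ V t s (g + ε) := by
      rw [hBellman t ht]
      exact le_csSup (hbdd t ht s (g + ε)) (mem_image_of_mem _ hu)
    have hcont := hstoch t g (g + ε) (by linarith) _
      (hV (s + tau * max u.2 0 - max (-u.2) 0 / rho)) (hVint _ _ _ _) (hVint _ _ _ _)
    have hpay := piecewise_linear_sub_le (z := (∑ k, u.1 k) + u.2 - g) (hpi t) hε
    rw [← hP, ← hP, sub_sub] at hpay
    rw [hΦ] at hle ⊢
    linarith
  have hVmono : ∀ n t, t + n = T → ∀ s, Monotone (V t s) := by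
    intro n
    induction n with
    | zero =>
      rintro t rfl s x y -
      exact (hVT s x).trans_le (hVT s y).ge
    | succ n ih =>
      intro t ht s x y hxy
      have h := step t (by omega) (ih (t + 1) (by omega)) s x (y - x) (sub_nonneg.2 hxy)
      rw [add_sub_cancel] at h
      linarith [mul_nonneg (hpim t) (sub_nonneg.2 hxy)]
  have hmonoV : ∀ t ≤ T, ∀ s, Monotone (V t s) := fun t ht =>
    hVmono (T - t) t (by omega)
  refine ⟨fun t ht s g _ _ ε hε => ?_, fun t ht s _ => (hmonoV t ht s).monotoneOn _,
    fun t ht hpos s _ x _ y _ hxy => ?_⟩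
  · split_ifs with h
    · simpa using hmonoV t ht s (le_add_of_nonneg_right hε.le)
    · have htT : t < T := lt_of_le_of_ne ht h
      exact step t htT (hmonoV (t + 1) htT) s g ε hε.le
  · have h := step t ht (hmonoV (t + 1) ht) s x (y - x) (sub_nonneg.2 hxy.le)
    rw [add_sub_cancel] at h
    have := mul_pos hpos (sub_pos.2 hxy)
    change V t s x < V t s y
    linarith
end

section
/- (Marginal value of storage.) For every stage t = 0,…,T, every state (s,g) with s ≥ 0, g ≥ 0, and every Δ ≥ 0, the value function satisfies the exact identity V_t(s+Δ, g) = V_t(s, g) + γ·Δ. -/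
open Set MeasureTheory ProbabilityTheory

theorem marginal_value_of_storage
    (T K : ℕ) (hK : 0 < K)
    (dbar : ℕ → Fin K → ℝ) (hdbar : ∀ t k, 0 < dbar t k)
    (U : ℕ → Fin K → ℝ → ℝ)
    (hconc : ∀ t k, StrictConcaveOn ℝ (Icc 0 (dbar t k)) (U t k))
    (hmono : ∀ t k, MonotoneOn (U t k) (Icc 0 (dbar t k)))
    (hC1 : ∀ t k, ContDiffOn ℝ 1 (U t k) (Icc 0 (dbar t k)))
    -- NEM X rates and payment functions
    (pim pip : ℕ → ℝ) (hpim : ∀ t, 0 ≤ pim t) (hpi : ∀ t, pim t ≤ pip t)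
    (P : ℕ → ℝ → ℝ) (hP : ∀ t z, P t z = pip t * max z 0 + pim t * min z 0)
    -- storage parameters
    (elow ebar : ℝ) (helow : 0 ≤ elow) (hebar : 0 ≤ ebar)
    (tau rho : ℝ) (htau : tau ∈ Ioc (0:ℝ) 1) (hrho : rho ∈ Ioc (0:ℝ) 1)
    (gam : ℝ) (hgam : 0 ≤ gam)
    -- feasible action set (state independent)
    (A : ℕ → Set ((Fin K → ℝ) × ℝ))
    (hA : ∀ t, A t = (univ.pi fun k => Icc 0 (dbar t k)) ×ˢ Icc (-elow) ebar)
    -- Markov transition kernels of the renewable process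
    (κ : ℕ → Kernel ℝ ℝ) (hκ : ∀ t, IsMarkovKernel (κ t))
    -- value functions, their measurability and integrability
    (V : ℕ → ℝ → ℝ → ℝ)
    (hVmeas : ∀ t s, Measurable (V t s))
    (hVint : ∀ t t' s g, Integrable (V t s) (κ t' g))
    -- terminal value
    (hVT : ∀ s g, V T s g = gam * s)
    -- Bellman objective and backward induction
    (Φ : ℕ → ℝ → ℝ → (Fin K → ℝ) × ℝ → ℝ)
    (hΦ : ∀ t s g u, Φ t s g u =
      (∑ k, U t k (u.1 k)) - P t ((∑ k, u.1 k) + u.2 - g)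
        + ∫ g', V (t + 1) (s + tau * max u.2 0 - max (-u.2) 0 / rho) g' ∂(κ t g))
    (hbdd : ∀ t < T, ∀ s g, BddAbove (Φ t s g '' A t))
    (hBellman : ∀ t < T, ∀ s g, V t s g = sSup (Φ t s g '' A t))
    :
    ∀ t ≤ T, ∀ s g : ℝ, 0 ≤ s → 0 ≤ g → ∀ Δ : ℝ, 0 ≤ Δ →
      V t (s + Δ) g = V t s g + gam * Δ := by
  suffices shift : ∀ t ≤ T, ∀ s g Δ : ℝ, V t (s + Δ) g = V t s g + gam * Δ from
    fun t ht s g _ _ Δ _ => shift t ht s g Δ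
  intro t ht
  induction ht using Nat.decreasingInduction with
  | self =>
    intro s g Δ
    rw [hVT, hVT]
    ring
  | of_succ t ht ih =>
    intro s g Δ
    have objective_shift : ∀ u, Φ t (s + Δ) g u = Φ t s g u + gam * Δ := by
      intro u
      have := hκ t
      rw [hΦ, hΦ]
      set s' := s + tau * max u.2 0 - max (-u.2) 0 / rho with hs'
      have next_state :
          s + Δ + tau * max u.2 0 - max (-u.2) 0 / rho = s' + Δ := by
        rw [hs']
        ring
      simp_rw [next_state, ih]
      rw [integral_add (hVint _ _ _ _) (integrable_const _), integral_const]
      simp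
      ring
    have nonempty : (A t).Nonempty := by
      refine ⟨(0, 0), ?_⟩
      rw [hA]
      exact ⟨fun k _ => ⟨le_rfl, (hdbar t k).le⟩, neg_nonpos.mpr helow, hebar⟩
    have image_shift : Φ t (s + Δ) g '' A t
        = OrderIso.addRight (gam * Δ) '' (Φ t s g '' A t) := by
      rw [image_image]
      exact image_congr fun u _ => objective_shift u
    rw [hBellman t ht, hBellman t ht, image_shift,
      ← OrderIso.map_csSup' _ (nonempty.image _) (hbdd t ht s g), OrderIso.addRight_apply]
end

section
/- (Storage–grid complementarity.) Under strict A1, every maximizer (d*, e*) of J over D × [−e̲, ē] satisfies e*·z* ≤ 0, where z* := Σ_k d*_k + e* − g; that is, the storage never charges while the prosumer is a strict net-consumer and never discharges while the prosumer is a strict net-producer. -/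
open Set

theorem storage_grid_complementarity
    (K : ℕ) (hK : 0 < K)
    (dbar : Fin K → ℝ) (hdbar : ∀ k, 0 < dbar k)
    (U : Fin K → ℝ → ℝ)
    (hconc : ∀ k, StrictConcaveOn ℝ (Icc 0 (dbar k)) (U k))
    (hmono : ∀ k, MonotoneOn (U k) (Icc 0 (dbar k)))
    (hC1 : ∀ k, ContDiffOn ℝ 1 (U k) (Icc 0 (dbar k)))
    -- NEM X rates
    (pim pip : ℝ) (hpim : 0 ≤ pim) (hpi : pim ≤ pip)
    (P : ℝ → ℝ) (hP : ∀ z, P z = pip * max z 0 + pim * min z 0)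
    -- storage parameters
    (elow ebar : ℝ) (helow : 0 ≤ elow) (hebar : 0 ≤ ebar)
    (tau rho : ℝ) (htau : tau ∈ Ioc (0:ℝ) 1) (hrho : rho ∈ Ioc (0:ℝ) 1)
    (gam : ℝ) (hgam : 0 ≤ gam)
    -- strict A1
    (hA1m : pim < tau * gam) (hA1p : gam / rho < pip)
    -- consumption set
    (D : Set (Fin K → ℝ)) (hD : D = univ.pi fun k => Icc 0 (dbar k))
    -- renewable generation
    (g : ℝ) (hg : 0 ≤ g)
    -- storage-adjusted stage surplus
    (J : (Fin K → ℝ) → ℝ → ℝ)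
    (hJ : ∀ d e, J d e = (∑ k, U k (d k)) - P ((∑ k, d k) + e - g)
        + gam * (tau * max e 0 - max (-e) 0 / rho))
    -- (dstar, estar) is a maximizer of J over D × [−e̲, ē]
    (dstar : Fin K → ℝ) (estar : ℝ)
    (hdstar : dstar ∈ D) (hestar : estar ∈ Icc (-elow) ebar)
    (hmax : ∀ d ∈ D, ∀ e ∈ Icc (-elow) ebar, J d e ≤ J dstar estar)
    :
    estar * ((∑ k, dstar k) + estar - g) ≤ 0 := by
  obtain ⟨htau0, htau1⟩ := htau
  obtain ⟨hrho0, hrho1⟩ := hrho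
  obtain ⟨helo, hehi⟩ := hestar
  have htg : tau * gam ≤ gam := mul_le_of_le_one_left hgam htau1
  have hgr : gam ≤ gam / rho := le_div_self hgam hrho0 hrho1
  by_contra! hpos
  rcases mul_pos_iff.mp hpos with ⟨he, hz⟩ | ⟨he, hz⟩
  · -- charging less by `t` saves `pip * t` and forgoes only `tau * gam * t`
    obtain ⟨t, ht, hte, htz⟩ : ∃ t, 0 < t ∧ t ≤ estar ∧ t ≤ (∑ k, dstar k) + estar - g :=
      ⟨_, lt_min he hz, min_le_left _ _, min_le_right _ _⟩
    have h := hmax dstar hdstar (estar - t) ⟨by linarith, by linarith⟩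
    rw [hJ, hJ, hP, hP, max_eq_left hz.le, min_eq_right hz.le, max_eq_left he.le,
      max_eq_right (by linarith : -estar ≤ 0),
      max_eq_left (by linarith : 0 ≤ (∑ k, dstar k) + (estar - t) - g),
      min_eq_right (by linarith : 0 ≤ (∑ k, dstar k) + (estar - t) - g),
      max_eq_left (by linarith : 0 ≤ estar - t),
      max_eq_right (by linarith : -(estar - t) ≤ 0)] at h
    have hgain : 0 < t * (pip - tau * gam) := mul_pos ht (by linarith)
    linarith
  · -- discharging less by `t` saves `gam / rho * t` and forgoes only `pim * t`
    obtain ⟨t, ht, hte, htz⟩ : ∃ t, 0 < t ∧ t ≤ -estar ∧ t ≤ -((∑ k, dstar k) + estar - g) :=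
      ⟨_, lt_min (neg_pos.mpr he) (neg_pos.mpr hz), min_le_left _ _, min_le_right _ _⟩
    have h := hmax dstar hdstar (estar + t) ⟨by linarith, by linarith⟩
    rw [hJ, hJ, hP, hP, max_eq_right hz.le, min_eq_left hz.le, max_eq_right he.le,
      max_eq_left (by linarith : 0 ≤ -estar),
      max_eq_right (by linarith : (∑ k, dstar k) + (estar + t) - g ≤ 0),
      min_eq_left (by linarith : (∑ k, dstar k) + (estar + t) - g ≤ 0),
      max_eq_right (by linarith : estar + t ≤ 0),
      max_eq_left (by linarith : 0 ≤ -(estar + t))] at h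
    have hgain : 0 < t * (gam / rho - pim) := mul_pos ht (by linarith)
    simp only [div_eq_mul_inv] at h hgain
    linarith
end

section
/- (Storage–consumption complementarity.) Under strict A1, every maximizer (d*, e*) of J over D × [−e̲, ē] satisfies e*·(Σ_k d*_k − g) ≤ 0; that is, the storage never charges when total consumption strictly exceeds renewable generation and never discharges when total consumption is strictly below renewable generation. -/
open Set

theorem storage_consumption_complementarity
    (K : ℕ) (hK : 0 < K)
    (dbar : Fin K → ℝ) (hdbar : ∀ k, 0 < dbar k)
    (U : Fin K → ℝ → ℝ)
    (hconc : ∀ k, StrictConcaveOn ℝ (Icc 0 (dbar k)) (U k))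
    (hmono : ∀ k, MonotoneOn (U k) (Icc 0 (dbar k)))
    (hC1 : ∀ k, ContDiffOn ℝ 1 (U k) (Icc 0 (dbar k)))
    -- NEM X rates
    (pim pip : ℝ) (hpim : 0 ≤ pim) (hpi : pim ≤ pip)
    (P : ℝ → ℝ) (hP : ∀ z, P z = pip * max z 0 + pim * min z 0)
    -- storage parameters
    (elow ebar : ℝ) (helow : 0 ≤ elow) (hebar : 0 ≤ ebar)
    (tau rho : ℝ) (htau : tau ∈ Ioc (0:ℝ) 1) (hrho : rho ∈ Ioc (0:ℝ) 1)
    (gam : ℝ) (hgam : 0 ≤ gam)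
    -- strict A1
    (hA1m : pim < tau * gam) (hA1p : gam / rho < pip)
    -- consumption set
    (D : Set (Fin K → ℝ)) (hD : D = univ.pi fun k => Icc 0 (dbar k))
    -- renewable generation
    (g : ℝ) (hg : 0 ≤ g)
    -- storage-adjusted stage surplus
    (J : (Fin K → ℝ) → ℝ → ℝ)
    (hJ : ∀ d e, J d e = (∑ k, U k (d k)) - P ((∑ k, d k) + e - g)
        + gam * (tau * max e 0 - max (-e) 0 / rho))
    -- (dstar, estar) is a maximizer of J over D × [−e̲, ē]
    (dstar : Fin K → ℝ) (estar : ℝ)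
    (hdstar : dstar ∈ D) (hestar : estar ∈ Icc (-elow) ebar)
    (hmax : ∀ d ∈ D, ∀ e ∈ Icc (-elow) ebar, J d e ≤ J dstar estar)
    :
    estar * ((∑ k, dstar k) - g) ≤ 0 := by
  have hmul : gam * tau ≤ gam := mul_le_of_le_one_right hgam htau.2
  have hdiv : gam ≤ gam / rho := le_div_self hgam hrho.1 hrho.2
  -- In either violating case, leaving the storage idle is strictly better.
  have h := hmax dstar hdstar 0 ⟨by linarith, hebar⟩
  rw [hJ, hJ, hP, hP] at h
  set s := (∑ k, dstar k) - g with hs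
  rw [show (∑ k, dstar k) + 0 - g = s by rw [hs]; ring,
    show (∑ k, dstar k) + estar - g = s + estar by rw [hs]; ring] at h
  by_contra! hpos
  rcases mul_pos_iff.mp hpos with ⟨he, hs0⟩ | ⟨he, hs0⟩
  · rw [max_eq_left hs0.le, min_eq_right hs0.le, max_eq_left (by linarith : 0 ≤ s + estar),
      min_eq_right (by linarith : 0 ≤ s + estar), max_eq_left he.le,
      max_eq_right (by linarith : -estar ≤ 0)] at h
    simp only [max_self, neg_zero, zero_div] at h
    have hgain : 0 < (pip - gam * tau) * estar := mul_pos (by linarith) he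
    linarith
  · rw [max_eq_right hs0.le, min_eq_left hs0.le, max_eq_right (by linarith : s + estar ≤ 0),
      min_eq_left (by linarith : s + estar ≤ 0), max_eq_right he.le,
      max_eq_left (by linarith : 0 ≤ -estar)] at h
    simp only [max_self, neg_zero, zero_div] at h
    have hgain : 0 < (gam / rho - pim) * (-estar) := mul_pos (by linarith) (by linarith)
    have hcomm : gam * (-estar / rho) = gam / rho * (-estar) := by ring
    linarith
end

section
/- (Optimal storage operation for a fixed consumption level.) Fix any total consumption level d ≥ 0 and renewable generation g ≥ 0, and assume A1. Define e* := max{g − d, −e̲} if d ≥ g, and e* := min{g − d, ē} if d < g. Then e* maximizes h(e) := −P(d + e − g) + γ·(τ·max(e,0) − max(−e,0)/ρ) over e ∈ [−e̲, ē]. -/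
open Set

theorem optimal_storage_fixed_consumption
    -- NEM X rates
    (pim pip : ℝ) (hpim : 0 ≤ pim) (hpi : pim ≤ pip)
    (P : ℝ → ℝ) (hP : ∀ z, P z = pip * max z 0 + pim * min z 0)
    -- storage parameters
    (elow ebar : ℝ) (helow : 0 ≤ elow) (hebar : 0 ≤ ebar)
    (tau rho : ℝ) (htau : tau ∈ Ioc (0:ℝ) 1) (hrho : rho ∈ Ioc (0:ℝ) 1)
    (gam : ℝ) (hgam : 0 ≤ gam)
    -- assumption A1
    (hA1m : pim ≤ tau * gam) (hA1p : gam / rho ≤ pip)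
    -- fixed total consumption and renewable generation
    (d g : ℝ) (hd : 0 ≤ d) (hg : 0 ≤ g)
    -- storage-adjusted stage objective at fixed consumption
    (h : ℝ → ℝ)
    (hh : ∀ e, h e = -P (d + e - g) + gam * (tau * max e 0 - max (-e) 0 / rho))
    -- the candidate optimal storage action
    (estar : ℝ)
    (hestar : estar = if g ≤ d then max (g - d) (-elow) else min (g - d) ebar) :
    estar ∈ Icc (-elow) ebar ∧ IsMaxOn h (Icc (-elow) ebar) estar := by
  obtain ⟨htau0, htau1⟩ := htau
  obtain ⟨hrho0, hrho1⟩ := hrho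
  have hgr : gam ≤ gam / rho := by
    rw [le_div_iff₀ hrho0]
    nlinarith
  have htg : tau * gam ≤ gam := by nlinarith
  have hh' : ∀ e, h e = -(pip * max (d + e - g) 0 + pim * min (d + e - g) 0)
      + (tau * gam * max e 0 - gam / rho * max (-e) 0) := by
    intro e
    rw [hh, hP]
    ring
  clear hh hP
  generalize gam / rho = k at *
  generalize tau * gam = t at *
  have hpos : ∀ e, 0 ≤ e → t * max e 0 - k * max (-e) 0 = t * e := by
    intro e he
    rw [max_eq_left he, max_eq_right (by linarith)]
    ring
  have hneg : ∀ e, e ≤ 0 → t * max e 0 - k * max (-e) 0 = k * e := by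
    intro e he
    rw [max_eq_right he, max_eq_left (by linarith)]
    ring
  have hPpos : ∀ z, 0 ≤ z → pip * max z 0 + pim * min z 0 = pip * z := by
    intro z hz
    rw [max_eq_left hz, min_eq_right hz]
    ring
  have hPneg : ∀ z, z ≤ 0 → pip * max z 0 + pim * min z 0 = pim * z := by
    intro z hz
    rw [max_eq_right hz, min_eq_left hz]
    ring
  split_ifs at hestar with hdg
  · have hs0 : estar ≤ 0 := by
      rw [hestar]
      exact max_le (by linarith) (by linarith)
    have hs1 : g - d ≤ estar := hestar ▸ le_max_left _ _
    have hs2 : -elow ≤ estar := hestar ▸ le_max_right _ _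
    refine ⟨⟨hs2, by linarith⟩, fun e ⟨he1, _⟩ => ?_⟩
    change h e ≤ h estar
    rw [hh', hh', hneg estar hs0, hPpos (d + estar - g) (by linarith)]
    rcases le_or_gt estar e with hse | hse
    · rw [hPpos (d + e - g) (by linarith)]
      rcases le_total 0 e with he | he
      · rw [hpos e he]
        nlinarith
      · rw [hneg e he]
        nlinarith
    · have hs : estar = g - d := by
        rcases max_choice (g - d) (-elow) with hc | hc <;> linarith
      rw [hPneg (d + e - g) (by linarith), hneg e (by linarith)]
      subst hs
      nlinarith
  · have hs0 : 0 ≤ estar := by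
      rw [hestar]
      exact le_min (by linarith) hebar
    have hs1 : estar ≤ g - d := hestar ▸ min_le_left _ _
    have hs2 : estar ≤ ebar := hestar ▸ min_le_right _ _
    refine ⟨⟨by linarith, hs2⟩, fun e ⟨_, he2⟩ => ?_⟩
    change h e ≤ h estar
    rw [hh', hh', hpos estar hs0, hPneg (d + estar - g) (by linarith)]
    rcases le_or_gt e estar with hse | hse
    · rw [hPneg (d + e - g) (by linarith)]
      rcases le_total 0 e with he | he
      · rw [hpos e he]
        nlinarith
      · rw [hneg e he]
        nlinarith
    · have hs : estar = g - d := by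
        rcases min_choice (g - d) ebar with hc | hc <;> linarith
      rw [hPpos (d + e - g) (by linarith), hpos e (by linarith)]
      subst hs
      nlinarith
end

section
/- (Charging never exceeds renewable generation.) Under strict A1, every maximizer (d*, e*) of J over D × [−e̲, ē] satisfies e* ≤ g. -/
open Set

theorem charging_bounded_by_generation
    (K : ℕ) (hK : 0 < K)
    (dbar : Fin K → ℝ) (hdbar : ∀ k, 0 < dbar k)
    (U : Fin K → ℝ → ℝ)
    (hconc : ∀ k, StrictConcaveOn ℝ (Icc 0 (dbar k)) (U k))
    (hmono : ∀ k, MonotoneOn (U k) (Icc 0 (dbar k)))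
    (hC1 : ∀ k, ContDiffOn ℝ 1 (U k) (Icc 0 (dbar k)))
    -- NEM X rates
    (pim pip : ℝ) (hpim : 0 ≤ pim) (hpi : pim ≤ pip)
    (P : ℝ → ℝ) (hP : ∀ z, P z = pip * max z 0 + pim * min z 0)
    -- storage parameters
    (elow ebar : ℝ) (helow : 0 ≤ elow) (hebar : 0 ≤ ebar)
    (tau rho : ℝ) (htau : tau ∈ Ioc (0:ℝ) 1) (hrho : rho ∈ Ioc (0:ℝ) 1)
    (gam : ℝ) (hgam : 0 ≤ gam)
    -- strict A1
    (hA1m : pim < tau * gam) (hA1p : gam / rho < pip)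
    -- consumption set
    (D : Set (Fin K → ℝ)) (hD : D = univ.pi fun k => Icc 0 (dbar k))
    -- renewable generation
    (g : ℝ) (hg : 0 ≤ g)
    -- storage-adjusted stage surplus
    (J : (Fin K → ℝ) → ℝ → ℝ)
    (hJ : ∀ d e, J d e = (∑ k, U k (d k)) - P ((∑ k, d k) + e - g)
        + gam * (tau * max e 0 - max (-e) 0 / rho))
    -- (dstar, estar) is a maximizer of J over D × [−e̲, ē]
    (dstar : Fin K → ℝ) (estar : ℝ)
    (hdstar : dstar ∈ D) (hestar : estar ∈ Icc (-elow) ebar)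
    (hmax : ∀ d ∈ D, ∀ e ∈ Icc (-elow) ebar, J d e ≤ J dstar estar)
    :
    estar ≤ g := by
  by_contra! hlt
  have hsum : 0 ≤ ∑ k, dstar k := by
    subst hD
    exact Finset.sum_nonneg fun k _ => (hdstar k (mem_univ k)).1
  have hslope : gam * tau < pip := by
    have h₁ : gam * tau ≤ gam := mul_le_of_le_one_right hgam htau.2
    have h₂ : gam ≤ gam / rho := le_div_self hgam hrho.1 hrho.2
    linarith
  have hle := hmax dstar hdstar g ⟨by linarith, by linarith [hestar.2]⟩
  rw [hJ, hJ, hP, hP, max_eq_left (by linarith : 0 ≤ (∑ k, dstar k) + g - g),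
    min_eq_right (by linarith : 0 ≤ (∑ k, dstar k) + g - g),
    max_eq_left (by linarith : 0 ≤ (∑ k, dstar k) + estar - g),
    min_eq_right (by linarith : 0 ≤ (∑ k, dstar k) + estar - g),
    max_eq_left hg, max_eq_left (by linarith : 0 ≤ estar),
    max_eq_right (by linarith : -g ≤ 0), max_eq_right (by linarith : -estar ≤ 0)] at hle
  have hgain : 0 < (pip - gam * tau) * (estar - g) :=
    mul_pos (sub_pos.2 hslope) (sub_pos.2 hlt)
  linarith
end

section
/- (Two-threshold structure of the optimal net consumption.) Under strict A1, define the thresholds Δ⁺ := f(π⁺) − e̲ and Δ⁻ := f(π⁻) + ē (so Δ⁺ ≤ Δ⁻). Every maximizer (d*, e*) of J over D × [−e̲, ē] has net consumption z* := Σ_k d*_k + e* − g given by: z* = Δ⁺ − g > 0 if g < Δ⁺ (net-consumption zone); z* = 0 if Δ⁺ ≤ g ≤ Δ⁻ (net-zero zone); and z* = Δ⁻ − g < 0 if g > Δ⁻ (net-production zone). -/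
open Set

/-- On a convex set, moving part of the way towards a strictly better point strictly increases a
concave function. -/
theorem ConcaveOn.lt_convexComb {s : Set ℝ} {φ : ℝ → ℝ} (hφ : ConcaveOn ℝ s φ) {x m t : ℝ}
    (hx : x ∈ s) (hm : m ∈ s) (hlt : φ x < φ m) (ht : t ∈ Ioc (0 : ℝ) 1) :
    φ x < φ ((1 - t) * x + t * m) := by
  have h := hφ.2 hx hm (sub_nonneg.2 ht.2) ht.1.le (by ring)
  simp only [smul_eq_mul] at h
  nlinarith [mul_pos ht.1 (sub_pos.2 hlt)]

/-- If moving part of the way from `(x, e)` towards the coordinatewise strict maximizer `(m, e₀)`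
does not increase a separable objective, then `(x, e) = (m, e₀)`. -/
theorem eq_of_separable_convexComb_le {ι : Type*} [Fintype ι] {s : ι → Set ℝ} {φ : ι → ℝ → ℝ}
    (hφ : ∀ k, ConcaveOn ℝ (s k) (φ k)) {x m : ι → ℝ} (hx : ∀ k, x k ∈ s k) (hm : ∀ k, m k ∈ s k)
    (hlt : ∀ k, x k ≠ m k → φ k (x k) < φ k (m k)) {v : ℝ → ℝ} {e e₀ t : ℝ}
    (ht : t ∈ Ioc (0 : ℝ) 1) (hv : e ≠ e₀ → v e < v ((1 - t) * e + t * e₀))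
    (hle : ∑ k, φ k ((1 - t) * x k + t * m k) + v ((1 - t) * e + t * e₀) ≤
      ∑ k, φ k (x k) + v e) :
    x = m ∧ e = e₀ := by
  have hstep : ∀ k, x k ≠ m k → φ k (x k) < φ k ((1 - t) * x k + t * m k) := fun k hk =>
    (hφ k).lt_convexComb (hx k) (hm k) (hlt k hk) ht
  have hstep_le : ∀ k, φ k (x k) ≤ φ k ((1 - t) * x k + t * m k) := by
    intro k
    by_cases hk : x k = m k
    · rw [← hk, ← add_mul, sub_add_cancel, one_mul]
    · exact (hstep k hk).le
  have hsum := Finset.sum_le_sum fun k (_ : k ∈ Finset.univ) => hstep_le k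
  have he : e = e₀ := by
    by_contra hne
    linarith [hv hne]
  refine ⟨funext fun k => ?_, he⟩
  by_contra hne
  have hsum_lt := Finset.sum_lt_sum (fun k (_ : k ∈ Finset.univ) => hstep_le k)
    ⟨k, Finset.mem_univ k, hstep k hne⟩
  rw [← he, ← add_mul, sub_add_cancel, one_mul] at hle
  linarith

/-- Increments of a two-slope function whose slope drops from `b` to `a` at `0` have slope between
`a` and `b`. -/
theorem two_slope_increment {a b x y : ℝ} (hab : a ≤ b) (hxy : x ≤ y) :
    a * (y - x) ≤ (a * max y 0 - b * max (-y) 0) - (a * max x 0 - b * max (-x) 0) ∧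
    (a * max y 0 - b * max (-y) 0) - (a * max x 0 - b * max (-x) 0) ≤ b * (y - x) := by
  rcases le_total 0 x with hx | hx <;> rcases le_total 0 y with hy | hy <;>
    simp only [max_eq_left, max_eq_right, hx, hy, neg_nonneg, neg_nonpos] <;>
    constructor <;> nlinarith

/-- A strict maximizer of `u x - p * x` is antitone in the price `p`. -/
theorem strict_maximizer_antitone {s : Set ℝ} {u : ℝ → ℝ} {p q a b : ℝ} (hqp : q ≤ p)
    (ha : a ∈ s) (hb : b ∈ s) (hamax : ∀ x ∈ s, x ≠ a → u x - p * x < u a - p * a)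
    (hbmax : ∀ x ∈ s, x ≠ b → u x - q * x < u b - q * b) : a ≤ b := by
  by_contra! h
  nlinarith [hamax b hb h.ne, hbmax a ha h.ne']

theorem two_threshold_net_consumption
    (K : ℕ) (hK : 0 < K)
    (dbar : Fin K → ℝ) (hdbar : ∀ k, 0 < dbar k)
    (U : Fin K → ℝ → ℝ)
    (hconc : ∀ k, StrictConcaveOn ℝ (Icc 0 (dbar k)) (U k))
    (hmono : ∀ k, MonotoneOn (U k) (Icc 0 (dbar k)))
    (hC1 : ∀ k, ContDiffOn ℝ 1 (U k) (Icc 0 (dbar k)))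
    -- NEM X rates
    (pim pip : ℝ) (hpim : 0 ≤ pim) (hpi : pim ≤ pip)
    (P : ℝ → ℝ) (hP : ∀ z, P z = pip * max z 0 + pim * min z 0)
    -- storage parameters
    (elow ebar : ℝ) (helow : 0 ≤ elow) (hebar : 0 ≤ ebar)
    (tau rho : ℝ) (htau : tau ∈ Ioc (0:ℝ) 1) (hrho : rho ∈ Ioc (0:ℝ) 1)
    (gam : ℝ) (hgam : 0 ≤ gam)
    -- strict A1
    (hA1m : pim < tau * gam) (hA1p : gam / rho < pip)
    -- consumption set
    (D : Set (Fin K → ℝ)) (hD : D = univ.pi fun k => Icc 0 (dbar k))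
    -- `f k π` is the unique maximizer of `x ↦ U k x − π x` over `[0, dbar k]`
    (f : Fin K → ℝ → ℝ)
    (hf : ∀ k, ∀ π : ℝ, 0 ≤ π → f k π ∈ Icc 0 (dbar k) ∧
      (∀ x ∈ Icc 0 (dbar k), x ≠ f k π → U k x - π * x < U k (f k π) - π * f k π))
    -- renewable generation
    (g : ℝ) (hg : 0 ≤ g)
    -- storage-adjusted stage surplus
    (J : (Fin K → ℝ) → ℝ → ℝ)
    (hJ : ∀ d e, J d e = (∑ k, U k (d k)) - P ((∑ k, d k) + e - g)
        + gam * (tau * max e 0 - max (-e) 0 / rho))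
    -- (dstar, estar) is a maximizer of J over D × [−e̲, ē]
    (dstar : Fin K → ℝ) (estar : ℝ)
    (hdstar : dstar ∈ D) (hestar : estar ∈ Icc (-elow) ebar)
    (hmax : ∀ d ∈ D, ∀ e ∈ Icc (-elow) ebar, J d e ≤ J dstar estar)
    :
    ((∑ k, f k pip) - elow ≤ (∑ k, f k pim) + ebar) ∧
    (g < (∑ k, f k pip) - elow →
      (∑ k, dstar k) + estar - g = ((∑ k, f k pip) - elow) - g ∧
      0 < (∑ k, dstar k) + estar - g) ∧
    ((∑ k, f k pip) - elow ≤ g ∧ g ≤ (∑ k, f k pim) + ebar →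
      (∑ k, dstar k) + estar - g = 0) ∧
    (g > (∑ k, f k pim) + ebar →
      (∑ k, dstar k) + estar - g = ((∑ k, f k pim) + ebar) - g ∧
      (∑ k, dstar k) + estar - g < 0) := by
  have hab : tau * gam ≤ gam / rho := by
    rw [le_div_iff₀ hrho.1]
    nlinarith [mul_nonneg (mul_nonneg htau.1.le hgam) (sub_nonneg.2 hrho.2),
      mul_nonneg hgam (sub_nonneg.2 htau.2)]
  have hpip : 0 ≤ pip := hpim.trans hpi
  have hDelta : (∑ k, f k pip) - elow ≤ (∑ k, f k pim) + ebar := by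
    have := Finset.sum_le_sum fun k (_ : k ∈ Finset.univ) =>
      strict_maximizer_antitone hpi (hf k pip hpip).1 (hf k pim hpim).1
        (hf k pip hpip).2 (hf k pim hpim).2
    linarith
  have hdmem : ∀ k, dstar k ∈ Icc 0 (dbar k) := fun k => (hD ▸ hdstar) k (mem_univ k)
  set a := tau * gam with ha
  set b := gam / rho with hb
  set V : ℝ → ℝ := fun e => a * max e 0 - b * max (-e) 0 with hV
  have hJV : ∀ d e, J d e = (∑ k, U k (d k)) - P ((∑ k, d k) + e - g) + V e := by
    intro d e
    rw [hJ]
    simp only [hV, ha, hb]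
    ring
  have hPpos : ∀ z, 0 ≤ z → P z = pip * z := fun z hz => by simp [hP, hz]
  have hPneg : ∀ z, z ≤ 0 → P z = pim * z := fun z hz => by simp [hP, hz]
  set z := (∑ k, dstar k) + estar - g with hz
  -- If the payment is linear with rate `p` at both ends of a segment from the maximizer towards
  -- the price-`p` optimum, then the maximizer is that optimum.
  have key : ∀ p e₀ t : ℝ, 0 ≤ p → e₀ ∈ Icc (-elow) ebar → t ∈ Ioc (0 : ℝ) 1 →
      (estar ≠ e₀ → V estar - p * estar <
        V ((1 - t) * estar + t * e₀) - p * ((1 - t) * estar + t * e₀)) →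
      P z = p * z →
      P ((1 - t) * z + t * ((∑ k, f k p) + e₀ - g)) =
        p * ((1 - t) * z + t * ((∑ k, f k p) + e₀ - g)) →
      z = (∑ k, f k p) + e₀ - g := by
    intro p e₀ t hp he₀ ht hv hPz hPt
    have hsum : (∑ k, ((1 - t) * dstar k + t * f k p)) =
        (1 - t) * ∑ k, dstar k + t * ∑ k, f k p := by
      rw [Finset.sum_add_distrib, Finset.mul_sum, Finset.mul_sum]
    have hnet : (∑ k, ((1 - t) * dstar k + t * f k p)) + ((1 - t) * estar + t * e₀) - g =
        (1 - t) * z + t * ((∑ k, f k p) + e₀ - g) := by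
      rw [hsum, hz]
      ring
    have hle := hmax (fun k => (1 - t) * dstar k + t * f k p)
      (by
        rw [hD]
        exact fun k _ => convex_Icc _ _ (hdmem k) (hf k p hp).1 (sub_nonneg.2 ht.2) ht.1.le
          (by ring))
      ((1 - t) * estar + t * e₀)
      (convex_Icc _ _ hestar he₀ (sub_nonneg.2 ht.2) ht.1.le (by ring))
    rw [hJV, hJV, hnet, hPt, ← hnet, ← hz, hPz, hz] at hle
    obtain ⟨hd, he⟩ := eq_of_separable_convexComb_le (s := fun k => Icc 0 (dbar k))
      (φ := fun k x => U k x - p * x) (x := dstar) (m := fun k => f k p)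
      (v := fun e => V e - p * e)
      (fun k => (hconc k).concaveOn.sub ((convexOn_id (convex_Icc _ _)).smul hp))
      hdmem (fun k => (hf k p hp).1) (fun k => (hf k p hp).2 _ (hdmem k)) ht hv
      (by
        simp only [Finset.sum_sub_distrib, ← Finset.mul_sum]
        linarith)
    rw [hz, hd, he]
  have hbuy : ∀ t ∈ Ioc (0 : ℝ) 1, 0 ≤ z →
      0 ≤ (1 - t) * z + t * ((∑ k, f k pip) - elow - g) →
      z = (∑ k, f k pip) - elow - g := by
    intro t ht hz0 hzt
    refine key pip (-elow) t hpip ⟨le_rfl, by linarith⟩ ht (fun hne => ?_) (hPpos z hz0)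
      (hPpos _ hzt)
    have hpos : 0 < t * (estar + elow) :=
      mul_pos ht.1 (by linarith [lt_of_le_of_ne hestar.1 hne.symm])
    have hinc := (two_slope_increment (x := (1 - t) * estar + t * -elow) (y := estar) hab
      (by linarith)).2
    simp only [hV]
    nlinarith [mul_pos (sub_pos.2 hA1p) hpos]
  have hsell : ∀ t ∈ Ioc (0 : ℝ) 1, z ≤ 0 →
      (1 - t) * z + t * ((∑ k, f k pim) + ebar - g) ≤ 0 →
      z = (∑ k, f k pim) + ebar - g := by
    intro t ht hz0 hzt
    refine key pim ebar t hpim ⟨by linarith, le_rfl⟩ ht (fun hne => ?_) (hPneg z hz0)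
      (hPneg _ hzt)
    have hpos : 0 < t * (ebar - estar) :=
      mul_pos ht.1 (by linarith [lt_of_le_of_ne hestar.2 hne])
    have hinc := (two_slope_increment (x := estar) (y := (1 - t) * estar + t * ebar) hab
      (by linarith)).1
    simp only [hV]
    nlinarith [mul_pos (sub_pos.2 hA1m) hpos]
  have hstep : ∀ x y : ℝ, 0 < x → ∃ t ∈ Ioc (0 : ℝ) 1, 0 ≤ (1 - t) * x + t * y := by
    intro x y hx
    have hden : 0 < x + |y| := add_pos_of_pos_of_nonneg hx (abs_nonneg y)
    refine ⟨x / (x + |y|), ⟨div_pos hx hden, ?_⟩, ?_⟩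
    · rw [div_le_one hden]
      linarith [abs_nonneg y]
    · have : (1 - x / (x + |y|)) * x + x / (x + |y|) * y = x * (|y| + y) / (x + |y|) := by
        field_simp
        ring
      rw [this]
      exact div_nonneg (mul_nonneg hx.le (by linarith [neg_abs_le y])) hden.le
  have hzpos : 0 < z → z = (∑ k, f k pip) - elow - g := fun h => by
    obtain ⟨t, ht, hzt⟩ := hstep z ((∑ k, f k pip) - elow - g) h
    exact hbuy t ht h.le hzt
  have hzneg : z < 0 → z = (∑ k, f k pim) + ebar - g := fun h => by
    obtain ⟨t, ht, hzt⟩ := hstep (-z) (-((∑ k, f k pim) + ebar - g)) (neg_pos.2 h)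
    exact hsell t ht h.le (by linarith)
  refine ⟨hDelta, fun hlow => ?_, fun hmid => ?_, fun hhigh => ?_⟩
  · have hz0 : 0 ≤ z := by
      by_contra! h
      linarith [hzneg h]
    have heq := hbuy 1 ⟨one_pos, le_rfl⟩ hz0 (by linarith)
    exact ⟨heq, by linarith⟩
  · rcases lt_trichotomy z 0 with h | h | h
    · linarith [hzneg h, hmid.2]
    · exact h
    · linarith [hzpos h, hmid.1]
  · have hz0 : z ≤ 0 := by
      by_contra! h
      linarith [hzpos h]
    have heq := hsell 1 ⟨one_pos, le_rfl⟩ hz0 (by linarith)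
    exact ⟨heq, by linarith⟩
end

section
/- (Monotonicity of the optimal consumption and storage policies.) Under strict A1, for each g ≥ 0 the maximizer (d*(g), e*(g)) of J over D × [−e̲, ē] is unique, and the maps g ↦ Σ_k d*_k(g) (optimal total consumption) and g ↦ e*(g) (optimal storage operation) are nondecreasing on [0, ∞). -/
open Set

/-- The part of the stage surplus not due to consumption utility, as a function of the storage
action `e` and the generation `x` left after consumption: `m ≤ p` are the export and import rates,
`q ≤ r` the marginal values of charging and discharging. -/
noncomputable def storageSurplus (m p q r e x : ℝ) : ℝ :=
  min (-(p * (e - x))) (-(m * (e - x))) + min (q * e) (r * e)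

theorem storageSurplus_concave (m p q r : ℝ) {a b : ℝ} (ha : 0 ≤ a) (hb : 0 ≤ b)
    (e x e' x' : ℝ) :
    a * storageSurplus m p q r e x + b * storageSurplus m p q r e' x' ≤
      storageSurplus m p q r (a * e + b * e') (a * x + b * x') := by
  have key : ∀ c d y z : ℝ, a * min (c * y) (d * y) + b * min (c * z) (d * z) ≤
      min (c * (a * y + b * z)) (d * (a * y + b * z)) := by
    intro c d y z
    refine le_min ?_ ?_
    · linarith [mul_le_mul_of_nonneg_left (min_le_left (c * y) (d * y)) ha,
        mul_le_mul_of_nonneg_left (min_le_left (c * z) (d * z)) hb]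
    · linarith [mul_le_mul_of_nonneg_left (min_le_right (c * y) (d * y)) ha,
        mul_le_mul_of_nonneg_left (min_le_right (c * z) (d * z)) hb]
  have h1 := key (-p) (-m) (e - x) (e' - x')
  have h2 := key q r e e'
  have h3 : a * (e - x) + b * (e' - x') = a * e + b * e' - (a * x + b * x') := by ring
  rw [h3] at h1
  simp only [storageSurplus, ← neg_mul]
  linarith

theorem storageSurplus_lt_of_lt_of_le {m p q r : ℝ} (hmq : m < q) (hqr : q ≤ r) (hrp : r < p)
    {a b x : ℝ} (hab : a < b) (hbx : b ≤ x) :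
    storageSurplus m p q r a x < storageSurplus m p q r b x := by
  have ha : min (-(p * (a - x))) (-(m * (a - x))) = -(m * (a - x)) :=
    min_eq_right (by nlinarith)
  have hb : min (-(p * (b - x))) (-(m * (b - x))) = -(m * (b - x)) :=
    min_eq_right (by nlinarith)
  have hw : min (q * a) (r * a) + q * (b - a) ≤ min (q * b) (r * b) := by
    refine le_min ?_ ?_
    · linarith [min_le_left (q * a) (r * a)]
    · nlinarith [min_le_right (q * a) (r * a)]
  unfold storageSurplus
  rw [ha, hb]
  nlinarith

theorem storageSurplus_lt_of_le_of_lt {m p q r : ℝ} (hmq : m < q) (hqr : q ≤ r) (hrp : r < p)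
    {b c x : ℝ} (hxb : x ≤ b) (hbc : b < c) :
    storageSurplus m p q r c x < storageSurplus m p q r b x := by
  have hb : min (-(p * (b - x))) (-(m * (b - x))) = -(p * (b - x)) :=
    min_eq_left (by nlinarith)
  have hc : min (-(p * (c - x))) (-(m * (c - x))) = -(p * (c - x)) :=
    min_eq_left (by nlinarith)
  have hw : min (q * c) (r * c) - r * (c - b) ≤ min (q * b) (r * b) := by
    refine le_min ?_ ?_
    · nlinarith [min_le_left (q * c) (r * c)]
    · linarith [min_le_right (q * c) (r * c)]
  unfold storageSurplus
  rw [hb, hc]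
  nlinarith

/-- The optimal storage action follows the remaining generation `x` as far as the limits allow. -/
theorem eq_clamp_of_storageSurplus_le {m p q r : ℝ} (hmq : m < q) (hqr : q ≤ r) (hrp : r < p)
    {l u e x : ℝ} (he : e ∈ Icc l u)
    (hmax : ∀ c ∈ Icc l u, storageSurplus m p q r c x ≤ storageSurplus m p q r e x) :
    e = max l (min u x) := by
  obtain ⟨hle, heu⟩ := he
  have hmem : max l (min u x) ∈ Icc l u :=
    ⟨le_max_left _ _, max_le (hle.trans heu) (min_le_left _ _)⟩
  have h := hmax _ hmem
  rcases lt_trichotomy e (max l (min u x)) with hlt | heq | hgt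
  · rcases lt_max_iff.1 hlt with h' | h'
    · exact absurd h' hle.not_gt
    · rw [max_eq_right (hle.trans h'.le)] at hlt h
      exact absurd h (storageSurplus_lt_of_lt_of_le hmq hqr hrp hlt (min_le_right _ _)).not_ge
  · exact heq
  · have hx : x ≤ max l (min u x) := by
      rcases min_lt_iff.1 ((le_max_right l (min u x)).trans_lt hgt) with h' | h'
      · exact absurd h' heu.not_gt
      · exact le_max_of_le_right (le_min (h'.le.trans heu) le_rfl)
    exact absurd h (storageSurplus_lt_of_le_of_lt hmq hqr hrp hx hgt).not_ge

theorem strictConcaveOn_sum_pi {ι : Type*} [Fintype ι] {s : ι → Set ℝ} {f : ι → ℝ → ℝ}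
    (hf : ∀ i, StrictConcaveOn ℝ (s i) (f i)) :
    StrictConcaveOn ℝ (univ.pi s) (fun d : ι → ℝ => ∑ i, f i (d i)) := by
  refine ⟨convex_pi fun i _ => (hf i).1, ?_⟩
  intro d hd d' hd' hne a b ha hb hab
  simp only [smul_eq_mul, Finset.mul_sum, ← Finset.sum_add_distrib]
  obtain ⟨j, hj⟩ := Function.ne_iff.1 hne
  refine Finset.sum_lt_sum (fun i _ => ?_) ⟨j, Finset.mem_univ j, ?_⟩
  · exact (hf i).concaveOn.2 (hd i trivial) (hd' i trivial) ha.le hb.le hab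
  · exact (hf j).2 (hd j trivial) (hd' j trivial) hj ha hb hab

theorem optimal_policy_unique_and_monotone
    (K : ℕ) (hK : 0 < K)
    (dbar : Fin K → ℝ) (hdbar : ∀ k, 0 < dbar k)
    (U : Fin K → ℝ → ℝ)
    (hconc : ∀ k, StrictConcaveOn ℝ (Icc 0 (dbar k)) (U k))
    (hmono : ∀ k, MonotoneOn (U k) (Icc 0 (dbar k)))
    (hC1 : ∀ k, ContDiffOn ℝ 1 (U k) (Icc 0 (dbar k)))
    -- NEM X rates
    (pim pip : ℝ) (hpim : 0 ≤ pim) (hpi : pim ≤ pip)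
    (P : ℝ → ℝ) (hP : ∀ z, P z = pip * max z 0 + pim * min z 0)
    -- storage parameters
    (elow ebar : ℝ) (helow : 0 ≤ elow) (hebar : 0 ≤ ebar)
    (tau rho : ℝ) (htau : tau ∈ Ioc (0:ℝ) 1) (hrho : rho ∈ Ioc (0:ℝ) 1)
    (gam : ℝ) (hgam : 0 ≤ gam)
    -- strict A1
    (hA1m : pim < tau * gam) (hA1p : gam / rho < pip)
    -- consumption set
    (D : Set (Fin K → ℝ)) (hD : D = univ.pi fun k => Icc 0 (dbar k))
    -- storage-adjusted stage surplus, as a function of renewable generation g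
    (J : (Fin K → ℝ) → ℝ → ℝ → ℝ)
    (hJ : ∀ d e g, J d e g = (∑ k, U k (d k)) - P ((∑ k, d k) + e - g)
        + gam * (tau * max e 0 - max (-e) 0 / rho))
    :
    (∀ g : ℝ, 0 ≤ g → ∃! p : (Fin K → ℝ) × ℝ,
      p.1 ∈ D ∧ p.2 ∈ Icc (-elow) ebar ∧
        ∀ d ∈ D, ∀ e ∈ Icc (-elow) ebar, J d e g ≤ J p.1 p.2 g) ∧
    (∀ dstar : ℝ → Fin K → ℝ, ∀ estar : ℝ → ℝ,
      (∀ g : ℝ, 0 ≤ g → dstar g ∈ D ∧ estar g ∈ Icc (-elow) ebar ∧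
        ∀ d ∈ D, ∀ e ∈ Icc (-elow) ebar, J d e g ≤ J (dstar g) (estar g) g) →
      MonotoneOn (fun g => ∑ k, dstar g k) (Ici 0) ∧ MonotoneOn estar (Ici 0)) := by
  set q := gam * tau with hq
  set r := gam / rho with hr
  have hmq : pim < q := by rw [hq, mul_comm]; exact hA1m
  have hqr : q ≤ r := by
    have h1 : q ≤ gam := mul_le_of_le_one_right hgam htau.2
    have h2 : gam ≤ r := (le_div_iff₀ hrho.1).2 (mul_le_of_le_one_right hgam hrho.2)
    exact h1.trans h2
  have hJG : ∀ d e g, J d e g =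
      (∑ k, U k (d k)) + storageSurplus pim pip q r e (g - ∑ k, d k) := by
    intro d e g
    have h1 : ∀ z, P z = -min (-(pip * z)) (-(pim * z)) := by
      intro z
      rw [hP]
      rcases le_total 0 z with hz | hz
      · rw [max_eq_left hz, min_eq_right hz, min_eq_left (by nlinarith)]; ring
      · rw [max_eq_right hz, min_eq_left hz, min_eq_right (by nlinarith)]; ring
    have h2 : gam * (tau * max e 0 - max (-e) 0 / rho) = min (q * e) (r * e) := by
      rcases le_total 0 e with hz | hz
      · rw [max_eq_left hz, max_eq_right (by linarith), min_eq_left (by nlinarith), hq]; ring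
      · rw [max_eq_right hz, max_eq_left (by linarith), min_eq_right (by nlinarith), hr]; ring
    have h3 : (∑ k, d k) + e - g = e - (g - ∑ k, d k) := by ring
    rw [hJ, h1, h2, h3, storageSurplus]
    ring
  set F : (Fin K → ℝ) → ℝ := fun d => ∑ k, U k (d k) with hF
  have hFc : StrictConcaveOn ℝ D F := hD ▸ strictConcaveOn_sum_pi hconc
  replace hJG : ∀ d e g, J d e g = F d + storageSurplus pim pip q r e (g - ∑ k, d k) := hJG
  clear_value F q r
  have hsum : ∀ (a b : ℝ) (d d' : Fin K → ℝ),
      ∑ k, (a • d + b • d') k = a * ∑ k, d k + b * ∑ k, d' k := by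
    intro a b d d'
    simp [Finset.sum_add_distrib, Finset.mul_sum]
  have hclamp : ∀ g d e, d ∈ D → e ∈ Icc (-elow) ebar →
      (∀ d' ∈ D, ∀ e' ∈ Icc (-elow) ebar, J d' e' g ≤ J d e g) →
      e = max (-elow) (min ebar (g - ∑ k, d k)) := by
    intro g d e hd he hmax
    refine eq_clamp_of_storageSurplus_le hmq hqr hA1p he fun c hc => ?_
    have h := hmax d hd c hc
    rw [hJG, hJG] at h
    linarith
  have hEc : Convex ℝ (Icc (-elow) ebar) := convex_Icc _ _
  have huniq : ∀ g d e d' e', d ∈ D → e ∈ Icc (-elow) ebar → d' ∈ D → e' ∈ Icc (-elow) ebar →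
      (∀ d₁ ∈ D, ∀ e₁ ∈ Icc (-elow) ebar, J d₁ e₁ g ≤ J d e g) →
      J d e g ≤ J d' e' g → d = d' := by
    intro g d e d' e' hd he hd' he' hmax hle
    by_contra hne
    have h1 : (0 : ℝ) < 1 / 2 := by norm_num
    have h2 : (1 / 2 + 1 / 2 : ℝ) = 1 := by norm_num
    have h := hmax _ (hFc.1 hd hd' h1.le h1.le h2) _ (hEc he he' h1.le h1.le h2)
    have hlt := hFc.2 hd hd' hne h1 h1 h2
    have hG := storageSurplus_concave pim pip q r h1.le h1.le e (g - ∑ k, d k) e'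
      (g - ∑ k, d' k)
    have hx : 1 / 2 * (g - ∑ k, d k) + 1 / 2 * (g - ∑ k, d' k) =
        g - (1 / 2 * ∑ k, d k + 1 / 2 * ∑ k, d' k) := by ring
    rw [hx] at hG
    simp only [hJG, hsum, smul_eq_mul] at h hle hlt
    linarith
  refine ⟨fun g _ => ?_, ?_⟩
  · have hcomp : IsCompact (D ×ˢ Icc (-elow) ebar) :=
      (hD ▸ isCompact_univ_pi fun k => isCompact_Icc).prod isCompact_Icc
    have hne : (D ×ˢ Icc (-elow) ebar).Nonempty := by
      refine ⟨(0, 0), ?_, by simp [helow, hebar]⟩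
      rw [hD]
      exact fun k _ => ⟨le_rfl, (hdbar k).le⟩
    have hFcont : ContinuousOn F D := by
      rw [hF, hD]
      refine continuousOn_finsetSum _ fun k _ => ?_
      exact (hC1 k).continuousOn.comp (continuous_apply k).continuousOn fun d hd => hd k trivial
    have hcont : ContinuousOn (fun p : (Fin K → ℝ) × ℝ => J p.1 p.2 g)
        (D ×ˢ Icc (-elow) ebar) := by
      simp only [hJG]
      refine (hFcont.comp continuousOn_fst fun p hp => hp.1).add ?_
      unfold storageSurplus
      exact Continuous.continuousOn (by fun_prop)
    obtain ⟨p, hp, hmax⟩ := hcomp.exists_isMaxOn hne hcont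
    have hpmax : ∀ d ∈ D, ∀ e ∈ Icc (-elow) ebar, J d e g ≤ J p.1 p.2 g :=
      fun d hd e he => hmax (show (d, e) ∈ D ×ˢ Icc (-elow) ebar from ⟨hd, he⟩)
    refine ⟨p, ⟨hp.1, hp.2, hpmax⟩, ?_⟩
    rintro p' ⟨hd, he, hmax'⟩
    have hdd : p'.1 = p.1 := huniq g _ _ _ _ hd he hp.1 hp.2 hmax' (hpmax _ hd _ he)
    refine Prod.ext hdd ?_
    rw [hclamp g _ _ hd he hmax', hclamp g _ _ hp.1 hp.2 hpmax, hdd]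
  · intro dstar estar hopt
    have hS : MonotoneOn (fun g => ∑ k, dstar g k) (Ici 0) := by
      intro g hg g' hg' hgg
      obtain ⟨hd, he, hmax⟩ := hopt g hg
      obtain ⟨hd', he', hmax'⟩ := hopt g' hg'
      by_contra! hlt
      set S := ∑ k, dstar g k with hSdef
      set S' := ∑ k, dstar g' k with hSdef'
      have hpos : 0 < (g' - S') - (g - S) := by linarith
      -- Exchange the two consumptions and interpolate the storage actions to match.
      obtain ⟨s, hs⟩ : ∃ s, s = (S - S') / ((g' - S') - (g - S)) := ⟨_, rfl⟩
      have hs0 : 0 ≤ s := hs ▸ div_nonneg (by linarith) hpos.le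
      have hs1 : 0 ≤ 1 - s := sub_nonneg.2 (hs ▸ (div_le_one hpos).2 (by linarith))
      have hsx : s * ((g' - S') - (g - S)) = S - S' := by
        rw [hs, div_mul_cancel₀ _ hpos.ne']
      have hx : (1 - s) * (g - S) + s * (g' - S') = g - S' := by linarith
      have hx' : s * (g - S) + (1 - s) * (g' - S') = g' - S := by linarith
      have hG := storageSurplus_concave pim pip q r hs1 hs0 (estar g) (g - S) (estar g') (g' - S')
      have hG' := storageSurplus_concave pim pip q r hs0 hs1 (estar g) (g - S) (estar g')
        (g' - S')
      rw [hx] at hG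
      rw [hx'] at hG'
      have hm := hEc he he' hs1 hs0 (by ring)
      have hm' := hEc he he' hs0 hs1 (by ring)
      have h' := hmax' _ hd _ hm'
      have hle : J (dstar g) (estar g) g ≤
          J (dstar g') ((1 - s) • estar g + s • estar g') g := by
        simp only [hJG, smul_eq_mul, ← hSdef, ← hSdef'] at h' ⊢
        linarith
      have heq := huniq g _ _ _ _ hd he hd' hm hmax hle
      rw [hSdef, hSdef', heq] at hlt
      exact lt_irrefl _ hlt
    refine ⟨hS, ?_⟩
    intro g hg g' hg' hgg
    obtain ⟨hd, he, hmax⟩ := hopt g hg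
    obtain ⟨hd', he', hmax'⟩ := hopt g' hg'
    rw [hclamp g _ _ hd he hmax, hclamp g' _ _ hd' he' hmax']
    refine max_le_max le_rfl (min_le_min le_rfl ?_)
    by_contra! hlt
    set S := ∑ k, dstar g k with hSdef
    set S' := ∑ k, dstar g' k with hSdef'
    have hpos : 0 < S' - S := by linarith
    -- Exchange the two storage actions and interpolate the consumptions to match.
    obtain ⟨s, hs⟩ : ∃ s, s = ((g - S) - (g' - S')) / (S' - S) := ⟨_, rfl⟩
    have hs0 : 0 < s := hs ▸ div_pos (by linarith) hpos
    have hs1 : 0 ≤ 1 - s := sub_nonneg.2 (hs ▸ (div_le_one hpos).2 (by linarith))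
    have hsx : s * (S' - S) = (g - S) - (g' - S') := by
      rw [hs, div_mul_cancel₀ _ hpos.ne']
    have hx : g - ((1 - s) * S + s * S') = g' - S' := by linarith
    have hx' : g' - (s * S + (1 - s) * S') = g - S := by linarith
    have hF1 := hFc.concaveOn.2 hd hd' hs1 hs0.le (by ring)
    have hF2 := hFc.concaveOn.2 hd hd' hs0.le hs1 (by ring)
    have hm := hFc.1 hd hd' hs1 hs0.le (by ring)
    have h' := hmax' _ (hFc.1 hd hd' hs0.le hs1 (by ring)) _ he
    have hle : J (dstar g) (estar g) g ≤
        J ((1 - s) • dstar g + s • dstar g') (estar g') g := by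
      simp only [hJG, hsum, smul_eq_mul, ← hSdef, ← hSdef', hx, hx'] at h' hF1 hF2 ⊢
      linarith
    have heq := congrArg (fun d => ∑ k, d k) (huniq g _ _ _ _ hd he hm he' hmax hle)
    simp only [hsum, ← hSdef, ← hSdef'] at heq
    nlinarith
end

section
/- (Monotonicity of the optimal net consumption.) Under strict A1, for each g ≥ 0 let (d*(g), e*(g)) be the unique maximizer of J over D × [−e̲, ē]. Then the optimal net consumption g ↦ z*(g) := Σ_k d*_k(g) + e*(g) − g is nonincreasing on [0, ∞). -/
open Set

/-- The salvage value of a storage action is concave when the round-trip efficiency is at most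
one. -/
theorem concaveOn_storage_value {tau rho gam : ℝ} (htau : tau ≤ 1) (hrho : rho ∈ Ioc (0 : ℝ) 1)
    (hgam : 0 ≤ gam) :
    ConcaveOn ℝ univ fun e : ℝ => gam * (tau * max e 0 - max (-e) 0 / rho) := by
  refine ⟨convex_univ, fun a _ b _ u v hu hv _ => ?_⟩
  have hrho' : 1 ≤ rho⁻¹ := (one_le_inv₀ hrho.1).2 hrho.2
  have hpos (x : ℝ) : max x 0 = x + max (-x) 0 := by
    rcases le_total 0 x with hx | hx
    · rw [max_eq_left hx, max_eq_right (by linarith)]; ring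
    · rw [max_eq_right hx, max_eq_left (by linarith)]; ring
  have hconv : max (-(u * a + v * b)) 0 ≤ u * max (-a) 0 + v * max (-b) 0 := by
    have ha := mul_le_mul_of_nonneg_left (le_max_left (-a) 0) hu
    have hb := mul_le_mul_of_nonneg_left (le_max_left (-b) 0) hv
    refine max_le (by linarith) ?_
    positivity
  have hcoef : 0 ≤ gam * (rho⁻¹ - tau) := mul_nonneg hgam (by linarith)
  have key := mul_le_mul_of_nonneg_left hconv hcoef
  simp only [smul_eq_mul, div_eq_mul_inv]
  rw [hpos a, hpos b, hpos (u * a + v * b)]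
  linarith

/-- If `F` is concave, swapping two points `x`, `y` for the convex combinations with weights
`(1 - t, t)` and `(t, 1 - t)` does not decrease the total value. -/
theorem ConcaveOn.add_le_add_swap {E : Type*} [AddCommGroup E] [Module ℝ E] {s : Set E}
    {F : E → ℝ} (hF : ConcaveOn ℝ s F) {x y : E} (hx : x ∈ s) (hy : y ∈ s) {t : ℝ}
    (ht : t ∈ Icc (0 : ℝ) 1) :
    F x + F y ≤ F ((1 - t) • x + t • y) + F (t • x + (1 - t) • y) := by
  have h1 := hF.2 hx hy (sub_nonneg.2 ht.2) ht.1 (sub_add_cancel 1 t)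
  have h2 := hF.2 hx hy ht.1 (sub_nonneg.2 ht.2) (add_sub_cancel t 1)
  simp only [smul_eq_mul] at h1 h2
  linarith

theorem optimal_net_consumption_antitone
    (K : ℕ) (hK : 0 < K)
    (dbar : Fin K → ℝ) (hdbar : ∀ k, 0 < dbar k)
    (U : Fin K → ℝ → ℝ)
    (hconc : ∀ k, StrictConcaveOn ℝ (Icc 0 (dbar k)) (U k))
    (hmono : ∀ k, MonotoneOn (U k) (Icc 0 (dbar k)))
    (hC1 : ∀ k, ContDiffOn ℝ 1 (U k) (Icc 0 (dbar k)))
    -- NEM X rates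
    (pim pip : ℝ) (hpim : 0 ≤ pim) (hpi : pim ≤ pip)
    (P : ℝ → ℝ) (hP : ∀ z, P z = pip * max z 0 + pim * min z 0)
    -- storage parameters
    (elow ebar : ℝ) (helow : 0 ≤ elow) (hebar : 0 ≤ ebar)
    (tau rho : ℝ) (htau : tau ∈ Ioc (0:ℝ) 1) (hrho : rho ∈ Ioc (0:ℝ) 1)
    (gam : ℝ) (hgam : 0 ≤ gam)
    -- strict A1
    (hA1m : pim < tau * gam) (hA1p : gam / rho < pip)
    -- consumption set
    (D : Set (Fin K → ℝ)) (hD : D = univ.pi fun k => Icc 0 (dbar k))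
    -- storage-adjusted stage surplus, as a function of renewable generation g
    (J : (Fin K → ℝ) → ℝ → ℝ → ℝ)
    (hJ : ∀ d e g, J d e g = (∑ k, U k (d k)) - P ((∑ k, d k) + e - g)
        + gam * (tau * max e 0 - max (-e) 0 / rho))
    -- (dstar g, estar g) is the unique maximizer of J(·,·,g) over D × [−e̲, ē]
    (dstar : ℝ → Fin K → ℝ) (estar : ℝ → ℝ)
    (hopt : ∀ g : ℝ, 0 ≤ g → dstar g ∈ D ∧ estar g ∈ Icc (-elow) ebar ∧
      ∀ d ∈ D, ∀ e ∈ Icc (-elow) ebar, J d e g ≤ J (dstar g) (estar g) g)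
    (huniq : ∀ g : ℝ, 0 ≤ g → ∀ d ∈ D, ∀ e ∈ Icc (-elow) ebar,
      (∀ d' ∈ D, ∀ e' ∈ Icc (-elow) ebar, J d' e' g ≤ J d e g) →
      d = dstar g ∧ e = estar g) :
    AntitoneOn (fun g => (∑ k, dstar g k) + estar g - g) (Ici 0) := by
  intro g₁ hg₁ g₂ hg₂ hg
  by_contra! hlt
  obtain ⟨hd₁, he₁, hmax₁⟩ := hopt g₁ hg₁
  obtain ⟨hd₂, he₂, hmax₂⟩ := hopt g₂ hg₂
  have huniq₁ := huniq g₁ hg₁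
  generalize dstar g₁ = d₁ at *
  generalize dstar g₂ = d₂ at *
  generalize estar g₁ = e₁ at *
  generalize estar g₂ = e₂ at *
  obtain ⟨t, ht, hts⟩ : ∃ t ∈ Icc (0 : ℝ) 1,
      t * ((∑ k, d₂ k) + e₂ - ((∑ k, d₁ k) + e₁)) =
        ((∑ k, d₂ k) + e₂ - g₂) - ((∑ k, d₁ k) + e₁ - g₁) := by
    have hs : 0 < (∑ k, d₂ k) + e₂ - ((∑ k, d₁ k) + e₁) := by linarith
    exact ⟨_, ⟨div_nonneg (by linarith) hs.le, (div_le_one hs).2 (by linarith)⟩,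
      div_mul_cancel₀ _ hs.ne'⟩
  have hDconv : Convex ℝ D := hD ▸ convex_pi fun k _ => convex_Icc _ _
  have h1t : 0 ≤ 1 - t := sub_nonneg.2 ht.2
  have hd' : (1 - t) • d₁ + t • d₂ ∈ D := hDconv hd₁ hd₂ h1t ht.1 (by ring)
  have hd'' : t • d₁ + (1 - t) • d₂ ∈ D := hDconv hd₁ hd₂ ht.1 h1t (by ring)
  have he' : (1 - t) • e₁ + t • e₂ ∈ Icc (-elow) ebar :=
    convex_Icc _ _ he₁ he₂ h1t ht.1 (by ring)
  have he'' : t • e₁ + (1 - t) • e₂ ∈ Icc (-elow) ebar :=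
    convex_Icc _ _ he₁ he₂ ht.1 h1t (by ring)
  have hz' : (∑ k, ((1 - t) • d₁ + t • d₂) k) + ((1 - t) • e₁ + t • e₂) - g₁ =
      (∑ k, d₂ k) + e₂ - g₂ := by
    simp only [Pi.add_apply, Pi.smul_apply, smul_eq_mul, Finset.sum_add_distrib,
      ← Finset.mul_sum]
    linarith
  have hz'' : (∑ k, (t • d₁ + (1 - t) • d₂) k) + (t • e₁ + (1 - t) • e₂) - g₂ =
      (∑ k, d₁ k) + e₁ - g₁ := by
    simp only [Pi.add_apply, Pi.smul_apply, smul_eq_mul, Finset.sum_add_distrib,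
      ← Finset.mul_sum]
    linarith
  have hU : (∑ k, U k (d₁ k)) + ∑ k, U k (d₂ k) ≤
      (∑ k, U k (((1 - t) • d₁ + t • d₂) k)) + ∑ k, U k ((t • d₁ + (1 - t) • d₂) k) := by
    rw [← Finset.sum_add_distrib, ← Finset.sum_add_distrib]
    rw [hD] at hd₁ hd₂
    exact Finset.sum_le_sum fun k _ =>
      (hconc k).concaveOn.add_le_add_swap (hd₁ k (mem_univ k)) (hd₂ k (mem_univ k)) ht
  have hS := (concaveOn_storage_value htau.2 hrho hgam).add_le_add_swap
    (mem_univ e₁) (mem_univ e₂) ht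
  have hJsum : J d₁ e₁ g₁ + J d₂ e₂ g₂ ≤
      J ((1 - t) • d₁ + t • d₂) ((1 - t) • e₁ + t • e₂) g₁ +
        J (t • d₁ + (1 - t) • d₂) (t • e₁ + (1 - t) • e₂) g₂ := by
    simp only [hJ, hz', hz'']
    linarith
  have hle := hmax₂ _ hd'' _ he''
  obtain ⟨hdeq, heeq⟩ := huniq₁ _ hd' _ he' fun d hd e he =>
    (hmax₁ d hd e he).trans (by linarith)
  rw [hdeq, heeq] at hz'
  linarith
end

section
/- (Optimal policy, net-consumption zone.) Under strict A1, if 0 ≤ g ≤ Δ⁺ := f(π⁺) − e̲, then the pair (d*, e*) with d*_k = f_k(π⁺) for every k and e* = −e̲ maximizes J over D × [−e̲, ē]; i.e., all devices consume at their standalone optimum for the retail rate π⁺ and the storage discharges at its maximum rate. -/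
open Set

/-- Under a tariff whose buy rate exceeds its sell rate, payment is at least the buy rate times
net consumption. -/
lemma mul_le_buy_max_add_sell_min {a b : ℝ} (hab : a ≤ b) (z : ℝ) :
    b * z ≤ b * max z 0 + a * min z 0 := by
  rcases le_total z 0 with hz | hz
  · rw [max_eq_right hz, min_eq_left hz]
    nlinarith
  · simp [max_eq_left hz, min_eq_right hz]

/-- The value of a storage action is at most what it is worth at the discharging rate. -/
lemma salvage_le_div_mul {tau rho gam : ℝ} (htau : tau ≤ 1) (hrho : rho ∈ Set.Ioc (0 : ℝ) 1)
    (hgam : 0 ≤ gam) (e : ℝ) :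
    gam * (tau * max e 0 - max (-e) 0 / rho) ≤ gam / rho * e := by
  rcases le_total e 0 with he | he
  · rw [max_eq_right he, max_eq_left (neg_nonneg.2 he)]
    exact le_of_eq (by ring)
  · rw [max_eq_left he, max_eq_right (neg_nonpos.2 he)]
    have h : gam ≤ gam / rho := le_div_self hgam hrho.1 hrho.2
    calc gam * (tau * e - 0 / rho) = gam * tau * e := by ring
      _ ≤ gam / rho * e := by
        gcongr
        exact (mul_le_of_le_one_right hgam htau).trans h

theorem optimal_policy_net_consumption_zone
    (K : ℕ) (hK : 0 < K)
    (dbar : Fin K → ℝ) (hdbar : ∀ k, 0 < dbar k)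
    (U : Fin K → ℝ → ℝ)
    (hconc : ∀ k, StrictConcaveOn ℝ (Icc 0 (dbar k)) (U k))
    (hmono : ∀ k, MonotoneOn (U k) (Icc 0 (dbar k)))
    (hC1 : ∀ k, ContDiffOn ℝ 1 (U k) (Icc 0 (dbar k)))
    -- NEM X rates
    (pim pip : ℝ) (hpim : 0 ≤ pim) (hpi : pim ≤ pip)
    (P : ℝ → ℝ) (hP : ∀ z, P z = pip * max z 0 + pim * min z 0)
    -- storage parameters
    (elow ebar : ℝ) (helow : 0 ≤ elow) (hebar : 0 ≤ ebar)
    (tau rho : ℝ) (htau : tau ∈ Ioc (0:ℝ) 1) (hrho : rho ∈ Ioc (0:ℝ) 1)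
    (gam : ℝ) (hgam : 0 ≤ gam)
    -- strict A1
    (hA1m : pim < tau * gam) (hA1p : gam / rho < pip)
    -- consumption set
    (D : Set (Fin K → ℝ)) (hD : D = univ.pi fun k => Icc 0 (dbar k))
    -- `f k π` is the unique maximizer of `x ↦ U k x − π x` over `[0, dbar k]`
    (f : Fin K → ℝ → ℝ)
    (hf : ∀ k, ∀ π : ℝ, 0 ≤ π → f k π ∈ Icc 0 (dbar k) ∧
      (∀ x ∈ Icc 0 (dbar k), x ≠ f k π → U k x - π * x < U k (f k π) - π * f k π))
    -- renewable generation
    (g : ℝ) (hg : 0 ≤ g)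
    -- storage-adjusted stage surplus
    (J : (Fin K → ℝ) → ℝ → ℝ)
    (hJ : ∀ d e, J d e = (∑ k, U k (d k)) - P ((∑ k, d k) + e - g)
        + gam * (tau * max e 0 - max (-e) 0 / rho))
    -- g in the net-consumption zone: 0 ≤ g ≤ Δ⁺ = f(π⁺) − e̲
    (hzone : g ≤ (∑ k, f k pip) - elow) :
    (fun k => f k pip) ∈ D ∧ -elow ∈ Icc (-elow) ebar ∧
    ∀ d ∈ D, ∀ e ∈ Icc (-elow) ebar, J d e ≤ J (fun k => f k pip) (-elow) := by
  have hpip : 0 ≤ pip := hpim.trans hpi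
  refine ⟨?_, ⟨le_rfl, by linarith⟩, ?_⟩
  · rw [hD]
    exact fun k _ => (hf k pip hpip).1
  intro d hd e he
  rw [hD] at hd
  have hsum : ∑ k, (U k (d k) - pip * d k) ≤ ∑ k, (U k (f k pip) - pip * f k pip) := by
    refine Finset.sum_le_sum fun k _ => ?_
    by_cases h : d k = f k pip
    · rw [h]
    · exact ((hf k pip hpip).2 (d k) (hd k (mem_univ k)) h).le
  simp only [Finset.sum_sub_distrib, ← Finset.mul_sum] at hsum
  have hpay := mul_le_buy_max_add_sell_min hpi ((∑ k, d k) + e - g)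
  have hsalv := salvage_le_div_mul htau.2 hrho hgam e
  have hstore : 0 ≤ (pip - gam / rho) * (e + elow) :=
    mul_nonneg (by linarith) (by linarith [he.1])
  have hz : 0 ≤ (∑ k, f k pip) + -elow - g := by linarith
  rw [hJ, hJ, hP, hP, max_eq_left hz, min_eq_right hz, max_eq_right (neg_nonpos.2 helow), neg_neg,
    max_eq_left helow]
  have hdis : gam * (tau * 0 - elow / rho) = -(gam / rho * elow) := by ring
  rw [hdis]
  linarith
end

section
/- (Optimal policy, net-production zone.) Under strict A1, if g ≥ Δ⁻ := f(π⁻) + ē, then the pair (d*, e*) with d*_k = f_k(π⁻) for every k and e* = ē maximizes J over D × [−e̲, ē]; i.e., all devices consume at their standalone optimum for the export rate π⁻ and the storage charges at its maximum rate. -/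
open Set

/-- A two-rate payment with buy rate at least the sell rate dominates the linear payment at the
sell rate. -/
theorem sellRate_mul_le_payment {pim pip : ℝ} (hpi : pim ≤ pip) (z : ℝ) :
    pim * z ≤ pip * max z 0 + pim * min z 0 := by
  rcases le_total z 0 with hz | hz
  · simp [hz]
  · simpa [hz] using mul_le_mul_of_nonneg_right hpi hz

/-- When the sell rate is below the effective charging value of storage, the net value of a storage
action priced at the sell rate is largest at the maximum charging rate. -/
theorem storage_value_le_of_sellRate_le {pim tau rho gam e ebar : ℝ} (hebar : 0 ≤ ebar)
    (htau : tau ≤ 1) (hrho : rho ∈ Ioc (0 : ℝ) 1) (hgam : 0 ≤ gam) (hpim : pim ≤ tau * gam)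
    (he : e ≤ ebar) :
    gam * (tau * max e 0 - max (-e) 0 / rho) - pim * e ≤ gam * (tau * ebar) - pim * ebar := by
  rcases le_total 0 e with h | h
  · rw [max_eq_left h, max_eq_right (neg_nonpos.2 h), zero_div]
    nlinarith [mul_nonneg (sub_nonneg.2 hpim) (sub_nonneg.2 he)]
  · rw [max_eq_right h, max_eq_left (neg_nonneg.2 h)]
    have hdiv : -e ≤ -e / rho := le_div_self (neg_nonneg.2 h) hrho.1 hrho.2
    have hpg : pim ≤ gam := hpim.trans (mul_le_of_le_one_left hgam htau)
    nlinarith [mul_le_mul_of_nonneg_left hdiv hgam,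
      mul_nonneg (sub_nonneg.2 hpg) (neg_nonneg.2 h),
      mul_nonneg (sub_nonneg.2 hpim) hebar]

theorem optimal_policy_net_production_zone
    (K : ℕ) (hK : 0 < K)
    (dbar : Fin K → ℝ) (hdbar : ∀ k, 0 < dbar k)
    (U : Fin K → ℝ → ℝ)
    (hconc : ∀ k, StrictConcaveOn ℝ (Icc 0 (dbar k)) (U k))
    (hmono : ∀ k, MonotoneOn (U k) (Icc 0 (dbar k)))
    (hC1 : ∀ k, ContDiffOn ℝ 1 (U k) (Icc 0 (dbar k)))
    -- NEM X rates
    (pim pip : ℝ) (hpim : 0 ≤ pim) (hpi : pim ≤ pip)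
    (P : ℝ → ℝ) (hP : ∀ z, P z = pip * max z 0 + pim * min z 0)
    -- storage parameters
    (elow ebar : ℝ) (helow : 0 ≤ elow) (hebar : 0 ≤ ebar)
    (tau rho : ℝ) (htau : tau ∈ Ioc (0:ℝ) 1) (hrho : rho ∈ Ioc (0:ℝ) 1)
    (gam : ℝ) (hgam : 0 ≤ gam)
    -- strict A1
    (hA1m : pim < tau * gam) (hA1p : gam / rho < pip)
    -- consumption set
    (D : Set (Fin K → ℝ)) (hD : D = univ.pi fun k => Icc 0 (dbar k))
    -- `f k π` is the unique maximizer of `x ↦ U k x − π x` over `[0, dbar k]`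
    (f : Fin K → ℝ → ℝ)
    (hf : ∀ k, ∀ π : ℝ, 0 ≤ π → f k π ∈ Icc 0 (dbar k) ∧
      (∀ x ∈ Icc 0 (dbar k), x ≠ f k π → U k x - π * x < U k (f k π) - π * f k π))
    -- renewable generation
    (g : ℝ) (hg : 0 ≤ g)
    -- storage-adjusted stage surplus
    (J : (Fin K → ℝ) → ℝ → ℝ)
    (hJ : ∀ d e, J d e = (∑ k, U k (d k)) - P ((∑ k, d k) + e - g)
        + gam * (tau * max e 0 - max (-e) 0 / rho))
    -- g in the net-production zone: g ≥ Δ⁻ = f(π⁻) + ē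
    (hzone : (∑ k, f k pim) + ebar ≤ g) :
    (fun k => f k pim) ∈ D ∧ ebar ∈ Icc (-elow) ebar ∧
    ∀ d ∈ D, ∀ e ∈ Icc (-elow) ebar, J d e ≤ J (fun k => f k pim) ebar := by
  subst hD
  refine ⟨fun k _ => (hf k pim hpim).1, ⟨by linarith, le_rfl⟩, fun d hd e he => ?_⟩
  have hU : ∑ k, (U k (d k) - pim * d k) ≤ ∑ k, (U k (f k pim) - pim * f k pim) := by
    refine Finset.sum_le_sum fun k _ => ?_
    by_cases h : d k = f k pim
    · rw [h]
    · exact ((hf k pim hpim).2 (d k) (hd k (mem_univ k)) h).le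
  simp only [Finset.sum_sub_distrib, ← Finset.mul_sum] at hU
  have hP_le := sellRate_mul_le_payment hpi ((∑ k, d k) + e - g)
  have hS := storage_value_le_of_sellRate_le hebar htau.2 hrho hgam hA1m.le he.2
  have hz : (∑ k, f k pim) + ebar - g ≤ 0 := by linarith
  rw [hJ, hJ, hP, hP, max_eq_right hz, min_eq_left hz, max_eq_left hebar,
    max_eq_right (neg_nonpos.2 hebar), zero_div]
  linarith
end

section
/- (Optimal policy, net-zero zone, maximum-discharge segment.) Under strict A1, if Δ⁺ < g ≤ σ⁺, where Δ⁺ := f(π⁺) − e̲ and σ⁺ := f(γ/ρ) − e̲, then the pair (d*, e*) with e* = −e̲ and d* the maximizer of U(d) over D subject to Σ_k d_k = g + e̲ maximizes J over D × [−e̲, ē]; in particular the net consumption is zero. -/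
open Set

/-- The chord inequality at the level `ℓ = s`, where `F` is at most `v`. -/
lemma ConcaveOn.chord_le_of_level_le {E : Type*} [AddCommGroup E] [Module ℝ E] {C : Set E}
    {F : E → ℝ} (hF : ConcaveOn ℝ C F) (ℓ : E →ₗ[ℝ] ℝ) {s v : ℝ}
    (hv : ∀ x ∈ C, ℓ x = s → F x ≤ v) {x y : E} (hx : x ∈ C) (hy : y ∈ C)
    (hxs : ℓ x ≤ s) (hsy : s ≤ ℓ y) (hxy : ℓ x < ℓ y) :
    (ℓ y - s) * F x + (s - ℓ x) * F y ≤ (ℓ y - ℓ x) * v := by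
  have hpos : 0 < ℓ y - ℓ x := sub_pos.2 hxy
  have h0 : 0 ≤ (ℓ y - s) / (ℓ y - ℓ x) := div_nonneg (sub_nonneg.2 hsy) hpos.le
  have h1 : 0 ≤ (s - ℓ x) / (ℓ y - ℓ x) := div_nonneg (sub_nonneg.2 hxs) hpos.le
  have h2 : (ℓ y - s) / (ℓ y - ℓ x) + (s - ℓ x) / (ℓ y - ℓ x) = 1 := by
    field_simp; ring
  have hlevel := hv _ (hF.1 hx hy h0 h1 h2) (by
    simp only [map_add, map_smul, smul_eq_mul]; field_simp; ring)
  have hle := (hF.2 hx hy h0 h1 h2).trans hlevel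
  simp only [smul_eq_mul] at hle
  rw [div_mul_eq_mul_div, div_mul_eq_mul_div, ← add_div, div_le_iff₀ hpos] at hle
  linarith

/-- A Lagrange multiplier in `[a, b]` for maximizing a concave function on the level `ℓ = s`,
given maximizers of the Lagrangians at `a` and `b` on either side of the level. -/
lemma ConcaveOn.exists_multiplier_mem_Icc {E : Type*} [AddCommGroup E] [Module ℝ E] {C : Set E}
    {F : E → ℝ} (hF : ConcaveOn ℝ C F) (ℓ : E →ₗ[ℝ] ℝ) {s v a b : ℝ} (hab : a ≤ b)
    (hv : ∀ x ∈ C, ℓ x = s → F x ≤ v) {p q : E} (hp : p ∈ C) (hq : q ∈ C)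
    (hsp : s ≤ ℓ p) (hqs : ℓ q ≤ s)
    (hpmax : ∀ x ∈ C, F x - a * ℓ x ≤ F p - a * ℓ p)
    (hqmax : ∀ x ∈ C, F x - b * ℓ x ≤ F q - b * ℓ q) :
    ∃ c ∈ Icc a b, ∀ x ∈ C, F x - c * ℓ x ≤ v - c * s := by
  have hleft : ∀ x ∈ C, ℓ x < s → a * (s - ℓ x) ≤ v - F x := by
    intro x hx hxs
    have hchord := hF.chord_le_of_level_le ℓ hv hx hp hxs.le hsp (hxs.trans_le hsp)
    have hmax := mul_le_mul_of_nonneg_left (hpmax x hx) (sub_pos.2 hxs).le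
    refine le_of_mul_le_mul_left ?_ (sub_pos.2 (hxs.trans_le hsp))
    linarith
  have hright : ∀ y ∈ C, s < ℓ y → F y - v ≤ b * (ℓ y - s) := by
    intro y hy hsy
    have hchord := hF.chord_le_of_level_le ℓ hv hq hy hqs hsy.le (hqs.trans_lt hsy)
    have hmax := mul_le_mul_of_nonneg_left (hqmax y hy) (sub_pos.2 hsy).le
    refine le_of_mul_le_mul_left ?_ (sub_pos.2 (hqs.trans_lt hsy))
    linarith
  obtain ⟨c, hc, hc'⟩ := exists_between_of_forall_le
    (s := insert a ((fun y => (F y - v) / (ℓ y - s)) '' {y ∈ C | s < ℓ y}))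
    (t := insert b ((fun x => (v - F x) / (s - ℓ x)) '' {x ∈ C | ℓ x < s}))
    (insert_nonempty _ _) (insert_nonempty _ _) (by
      rintro _ (rfl | ⟨y, ⟨hy, hsy⟩, rfl⟩) _ (rfl | ⟨x, ⟨hx, hxs⟩, rfl⟩)
      · exact hab
      · exact (le_div_iff₀ (sub_pos.2 hxs)).2 (hleft x hx hxs)
      · exact (div_le_iff₀ (sub_pos.2 hsy)).2 (hright y hy hsy)
      · have hchord := hF.chord_le_of_level_le ℓ hv hx hy hxs.le hsy.le (hxs.trans hsy)
        refine (div_le_div_iff₀ (sub_pos.2 hsy) (sub_pos.2 hxs)).2 ?_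
        linarith)
  refine ⟨c, ⟨hc (mem_insert _ _), hc' (mem_insert _ _)⟩, fun x hx => ?_⟩
  rcases lt_trichotomy (ℓ x) s with hxs | hxs | hxs
  · have := (le_div_iff₀ (sub_pos.2 hxs)).1
      (hc' (mem_insert_of_mem _ (mem_image_of_mem _ ⟨hx, hxs⟩)))
    linarith
  · have := hv x hx hxs
    rw [hxs]
    linarith
  · have := (div_le_iff₀ (sub_pos.2 hxs)).1
      (hc (mem_insert_of_mem _ (mem_image_of_mem _ ⟨hx, hxs⟩)))
    linarith

/-- A separable sum of concave functions is concave on the product of their domains. -/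
lemma concaveOn_pi_sum {ι : Type*} [Fintype ι] {s : ι → Set ℝ} {φ : ι → ℝ → ℝ}
    (h : ∀ i, ConcaveOn ℝ (s i) (φ i)) :
    ConcaveOn ℝ (univ.pi s) fun x : ι → ℝ => ∑ i, φ i (x i) := by
  refine ⟨convex_pi fun i _ => (h i).1, fun x hx y hy a b ha hb hab => ?_⟩
  simp only [Finset.smul_sum, ← Finset.sum_add_distrib]
  exact Finset.sum_le_sum fun i _ => (h i).2 (hx i trivial) (hy i trivial) ha hb hab

theorem optimal_policy_net_zero_max_discharge
    (K : ℕ) (hK : 0 < K)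
    (dbar : Fin K → ℝ) (hdbar : ∀ k, 0 < dbar k)
    (U : Fin K → ℝ → ℝ)
    (hconc : ∀ k, StrictConcaveOn ℝ (Icc 0 (dbar k)) (U k))
    (hmono : ∀ k, MonotoneOn (U k) (Icc 0 (dbar k)))
    (hC1 : ∀ k, ContDiffOn ℝ 1 (U k) (Icc 0 (dbar k)))
    -- NEM X rates
    (pim pip : ℝ) (hpim : 0 ≤ pim) (hpi : pim ≤ pip)
    (P : ℝ → ℝ) (hP : ∀ z, P z = pip * max z 0 + pim * min z 0)
    -- storage parameters
    (elow ebar : ℝ) (helow : 0 ≤ elow) (hebar : 0 ≤ ebar)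
    (tau rho : ℝ) (htau : tau ∈ Ioc (0:ℝ) 1) (hrho : rho ∈ Ioc (0:ℝ) 1)
    (gam : ℝ) (hgam : 0 ≤ gam)
    -- strict A1
    (hA1m : pim < tau * gam) (hA1p : gam / rho < pip)
    -- consumption set
    (D : Set (Fin K → ℝ)) (hD : D = univ.pi fun k => Icc 0 (dbar k))
    -- `f k π` is the unique maximizer of `x ↦ U k x − π x` over `[0, dbar k]`
    (f : Fin K → ℝ → ℝ)
    (hf : ∀ k, ∀ π : ℝ, 0 ≤ π → f k π ∈ Icc 0 (dbar k) ∧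
      (∀ x ∈ Icc 0 (dbar k), x ≠ f k π → U k x - π * x < U k (f k π) - π * f k π))
    -- renewable generation
    (g : ℝ) (hg : 0 ≤ g)
    -- storage-adjusted stage surplus
    (J : (Fin K → ℝ) → ℝ → ℝ)
    (hJ : ∀ d e, J d e = (∑ k, U k (d k)) - P ((∑ k, d k) + e - g)
        + gam * (tau * max e 0 - max (-e) 0 / rho))
    -- Δ⁺ < g ≤ σ⁺, where Δ⁺ = f(π⁺) − e̲ and σ⁺ = f(γ/ρ) − e̲
    (hzone₁ : (∑ k, f k pip) - elow < g) (hzone₂ : g ≤ (∑ k, f k (gam / rho)) - elow)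
    -- dstar maximizes U over D subject to Σ_k d_k = g + e̲
    (dstar : Fin K → ℝ) (hdstar : dstar ∈ D) (hsum : (∑ k, dstar k) = g + elow)
    (hUmax : ∀ d ∈ D, (∑ k, d k) = g + elow →
      (∑ k, U k (d k)) ≤ (∑ k, U k (dstar k))) :
    (-elow ∈ Icc (-elow) ebar) ∧
    (∀ d ∈ D, ∀ e ∈ Icc (-elow) ebar, J d e ≤ J dstar (-elow)) ∧
    (∑ k, dstar k) + (-elow) - g = 0 := by
  have hrho0 : 0 < rho := hrho.1
  have htg : tau * gam ≤ gam := mul_le_of_le_one_left hgam htau.2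
  have hgr : gam ≤ gam / rho := le_div_self hgam hrho0 hrho.2
  have hgr0 : 0 ≤ gam / rho := hgam.trans hgr
  have hmem : ∀ π : ℝ, 0 ≤ π → (fun k => f k π) ∈ D := by
    intro π hπ
    rw [hD]
    exact fun k _ => (hf k π hπ).1
  have hmax : ∀ π : ℝ, 0 ≤ π → ∀ d ∈ D,
      (∑ k, U k (d k)) - π * ∑ k, d k ≤ (∑ k, U k (f k π)) - π * ∑ k, f k π := by
    intro π hπ d hd
    rw [hD] at hd
    simp only [Finset.mul_sum, ← Finset.sum_sub_distrib]
    refine Finset.sum_le_sum fun k _ => ?_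
    rcases eq_or_ne (d k) (f k π) with h | h
    · rw [h]
    · exact ((hf k π hπ).2 _ (hd k trivial) h).le
  have hconcD : ConcaveOn ℝ D fun d : Fin K → ℝ => ∑ k, U k (d k) := by
    rw [hD]
    exact concaveOn_pi_sum fun k => (hconc k).concaveOn
  let ℓ : (Fin K → ℝ) →ₗ[ℝ] ℝ := ∑ k, LinearMap.proj k
  have hℓ : ∀ d, ℓ d = ∑ k, d k := fun d => by simp [ℓ]
  obtain ⟨c, ⟨hac, hcb⟩, hc⟩ := hconcD.exists_multiplier_mem_Icc ℓ
    (s := g + elow) (v := ∑ k, U k (dstar k)) hA1p.le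
    (fun d hd h => hUmax d hd (by rw [← hℓ, h]))
    (hmem _ hgr0) (hmem _ (hpim.trans hpi))
    (by rw [hℓ]; linarith) (by rw [hℓ]; linarith)
    (by simpa only [hℓ] using hmax _ hgr0)
    (by simpa only [hℓ] using hmax _ (hpim.trans hpi))
  have hnet : (∑ k, dstar k) + (-elow) - g = 0 := by linarith
  refine ⟨⟨le_rfl, by linarith⟩, fun d hd e he => ?_, hnet⟩
  have hd' := hc d hd
  rw [hℓ] at hd'
  rw [hJ, hJ, hnet, hP, hP]
  have hpay : ∀ z : ℝ, c * z ≤ pip * max z 0 + pim * min z 0 := by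
    intro z
    rcases le_total 0 z with hz | hz
    · rw [max_eq_left hz, min_eq_right hz]
      nlinarith
    · rw [max_eq_right hz, min_eq_left hz]
      nlinarith
  have hstore : gam * (tau * max e 0 - max (-e) 0 / rho) ≤ gam / rho * e := by
    rcases le_total 0 e with h | h
    · rw [max_eq_left h, max_eq_right (neg_nonpos.2 h), zero_div, sub_zero, ← mul_assoc]
      exact mul_le_mul_of_nonneg_right (by linarith) h
    · rw [max_eq_right h, max_eq_left (neg_nonneg.2 h)]
      exact le_of_eq (by ring)
  have hdis : gam * (tau * max (-elow) 0 - max (-(-elow)) 0 / rho) = -(gam / rho * elow) := by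
    rw [neg_neg, max_eq_right (neg_nonpos.2 helow), max_eq_left helow]
    ring
  rw [hdis, max_self, min_self]
  have hpay' := hpay ((∑ k, d k) + e - g)
  have hslope := mul_le_mul_of_nonneg_right hac (by linarith [he.1] : 0 ≤ e + elow)
  linarith
end

section
/- (Optimal policy, net-zero zone, partial-discharge segment.) Under strict A1, if σ⁺ < g < σ⁺ᵒ, where σ⁺ := f(γ/ρ) − e̲ and σ⁺ᵒ := f(γ/ρ), then the pair (d*, e*) with d*_k = f_k(γ/ρ) for every k and e* = g − f(γ/ρ) ∈ (−e̲, 0) maximizes J over D × [−e̲, ē]; i.e., devices consume at the standalone optimum for the effective price γ/ρ and the storage partially discharges, with zero net consumption. -/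
open Set

/-- A two-rate tariff dominates every linear tariff whose rate lies between its two rates. -/
theorem mul_le_mul_max_add_mul_min {a b c : ℝ} (hac : a ≤ c) (hcb : c ≤ b) (z : ℝ) :
    c * z ≤ b * max z 0 + a * min z 0 := by
  rcases le_total 0 z with hz | hz
  · rw [max_eq_left hz, min_eq_right hz]
    nlinarith
  · rw [max_eq_right hz, min_eq_left hz]
    nlinarith

theorem optimal_policy_net_zero_partial_discharge
    (K : ℕ) (hK : 0 < K)
    (dbar : Fin K → ℝ) (hdbar : ∀ k, 0 < dbar k)
    (U : Fin K → ℝ → ℝ)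
    (hconc : ∀ k, StrictConcaveOn ℝ (Icc 0 (dbar k)) (U k))
    (hmono : ∀ k, MonotoneOn (U k) (Icc 0 (dbar k)))
    (hC1 : ∀ k, ContDiffOn ℝ 1 (U k) (Icc 0 (dbar k)))
    -- NEM X rates
    (pim pip : ℝ) (hpim : 0 ≤ pim) (hpi : pim ≤ pip)
    (P : ℝ → ℝ) (hP : ∀ z, P z = pip * max z 0 + pim * min z 0)
    -- storage parameters
    (elow ebar : ℝ) (helow : 0 ≤ elow) (hebar : 0 ≤ ebar)
    (tau rho : ℝ) (htau : tau ∈ Ioc (0:ℝ) 1) (hrho : rho ∈ Ioc (0:ℝ) 1)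
    (gam : ℝ) (hgam : 0 ≤ gam)
    -- strict A1
    (hA1m : pim < tau * gam) (hA1p : gam / rho < pip)
    -- consumption set
    (D : Set (Fin K → ℝ)) (hD : D = univ.pi fun k => Icc 0 (dbar k))
    -- `f k π` is the unique maximizer of `x ↦ U k x − π x` over `[0, dbar k]`
    (f : Fin K → ℝ → ℝ)
    (hf : ∀ k, ∀ π : ℝ, 0 ≤ π → f k π ∈ Icc 0 (dbar k) ∧
      (∀ x ∈ Icc 0 (dbar k), x ≠ f k π → U k x - π * x < U k (f k π) - π * f k π))
    -- renewable generation
    (g : ℝ) (hg : 0 ≤ g)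
    -- storage-adjusted stage surplus
    (J : (Fin K → ℝ) → ℝ → ℝ)
    (hJ : ∀ d e, J d e = (∑ k, U k (d k)) - P ((∑ k, d k) + e - g)
        + gam * (tau * max e 0 - max (-e) 0 / rho))
    -- σ⁺ < g < σ⁺ᵒ, where σ⁺ = f(γ/ρ) − e̲ and σ⁺ᵒ = f(γ/ρ)
    (hzone₁ : (∑ k, f k (gam / rho)) - elow < g) (hzone₂ : g < (∑ k, f k (gam / rho))) :
    (g - (∑ k, f k (gam / rho)) ∈ Ioo (-elow) 0) ∧
    (fun k => f k (gam / rho)) ∈ D ∧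
    (∀ d ∈ D, ∀ e ∈ Icc (-elow) ebar,
      J d e ≤ J (fun k => f k (gam / rho)) (g - (∑ k, f k (gam / rho)))) ∧
    (∑ k, f k (gam / rho)) + (g - (∑ k, f k (gam / rho))) - g = 0 := by
  set F := ∑ k, f k (gam / rho) with hF
  set p := gam / rho with hp
  have hp0 : 0 ≤ p := div_nonneg hgam hrho.1.le
  have hgp : gam ≤ p := le_div_self hgam hrho.1 hrho.2
  have htg : tau * gam ≤ p := (mul_le_of_le_one_left hgam htau.2).trans hgp
  refine ⟨⟨by linarith, by linarith⟩, ?_, ?_, by ring⟩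
  · rw [hD]
    exact fun k _ => (hf k p hp0).1
  · intro d hd e _
    rw [hD] at hd
    have hU : ∑ k, (U k (d k) - p * d k) ≤ ∑ k, (U k (f k p) - p * f k p) := by
      refine Finset.sum_le_sum fun k _ => ?_
      by_cases h : d k = f k p
      · rw [h]
      · exact ((hf k p hp0).2 _ (hd k (mem_univ k)) h).le
    rw [Finset.sum_sub_distrib, Finset.sum_sub_distrib, ← Finset.mul_sum, ← Finset.mul_sum,
      ← hF] at hU
    have hpay : p * (∑ k, d k + e - g) ≤ P (∑ k, d k + e - g) := by
      rw [hP]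
      exact mul_le_mul_max_add_mul_min (hA1m.le.trans htg) hA1p.le _
    have hsalvage : ∀ x, gam * (tau * max x 0 - max (-x) 0 / rho)
        = tau * gam * max x 0 - p * max (-x) 0 := fun x => by
      rw [hp]
      ring
    have hstore : tau * gam * max e 0 - p * max (-e) 0 ≤ p * e := by
      have h₁ := mul_le_mul_of_nonneg_right htg (le_max_right e 0)
      have h₂ : max e 0 - max (-e) 0 = e := max_zero_sub_eq_self e
      have h₃ : p * max e 0 - p * max (-e) 0 = p * e := by rw [← mul_sub, h₂]
      linarith
    have hbalance : F + (g - F) - g = 0 := by ring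
    have hP0 : P 0 = 0 := by simp [hP]
    rw [hJ, hJ, hsalvage, hsalvage, ← hF, hbalance, hP0, max_eq_right (by linarith : g - F ≤ 0),
      max_eq_left (by linarith : 0 ≤ -(g - F))]
    linarith
end

section
/- (Optimal policy, net-zero zone, idle-storage segment.) Under strict A1, if σ⁺ᵒ ≤ g ≤ σ⁻ᵒ, where σ⁺ᵒ := f(γ/ρ) and σ⁻ᵒ := f(τγ) (note σ⁺ᵒ ≤ σ⁻ᵒ since τγ ≤ γ/ρ), then the pair (d*, e*) with e* = 0 and d* the maximizer of U(d) over D subject to Σ_k d_k = g maximizes J over D × [−e̲, ē]; i.e., the storage idles and the devices consume exactly the renewable generation. -/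
open Set

/-- A price response is antitone in the price. -/
theorem priceResponse_antitone {S : Set ℝ} {u : ℝ → ℝ} {p q x y : ℝ} (hpq : p ≤ q)
    (hx : x ∈ S) (hy : y ∈ S)
    (hxmax : ∀ z ∈ S, z ≠ x → u z - p * z < u x - p * x)
    (hymax : ∀ z ∈ S, z ≠ y → u z - q * z < u y - q * y) : y ≤ x := by
  by_contra! h
  have h1 := hxmax y hy h.ne'
  have h2 := hymax x hx h.ne
  nlinarith [mul_nonneg (sub_nonneg.2 hpq) (sub_nonneg.2 h.le)]

/-- If `p` maximizes a concave function `V` penalized by `c` times a linear functional `L`, and `g`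
lies between `L p` and `L d`, then some feasible point with `L`-value `g` does at least as well
as `d` in the penalized problem. -/
theorem ConcaveOn.exists_eq_of_penalized_max {E : Type*} [AddCommGroup E] [Module ℝ E]
    {S : Set E} {V : E → ℝ} (hV : ConcaveOn ℝ S V) (L : E →ₗ[ℝ] ℝ) {c g : ℝ} {p d : E}
    (hp : p ∈ S) (hd : d ∈ S) (hmax : V d - c * L d ≤ V p - c * L p)
    (hg : g ∈ segment ℝ (L p) (L d)) :
    ∃ x ∈ S, L x = g ∧ V d - c * (L d - g) ≤ V x := by
  obtain ⟨s, t, hs, ht, hst, rfl⟩ := hg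
  refine ⟨s • p + t • d, hV.1 hp hd hs ht hst, by simp, ?_⟩
  have h := hV.2 hp hd hs ht hst
  simp only [smul_eq_mul] at h ⊢
  obtain rfl : t = 1 - s := by linarith
  nlinarith [mul_le_mul_of_nonneg_left hmax hs]

/-- Under the storage price bounds, a household consuming at least its generation cannot beat
the storage discharge value `b` per unit of the deficit `x`. -/
theorem storage_value_sub_payment_le_of_nonneg {pim pip a b x e : ℝ} (ha : pim ≤ a) (hab : a ≤ b)
    (hb : b ≤ pip) (hx : 0 ≤ x) :
    -(pip * max (x + e) 0 + pim * min (x + e) 0) + (a * max e 0 - b * max (-e) 0) ≤ -(b * x) := by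
  rcases le_total 0 e with he | he <;> rcases le_total 0 (x + e) with hz | hz <;>
    simp only [he, hz, max_eq_left, max_eq_right, min_eq_left, min_eq_right,
      Left.neg_nonpos_iff, Left.nonneg_neg_iff] <;> nlinarith

/-- Under the storage price bounds, a household consuming at most its generation cannot beat
the storage charge value `a` per unit of the surplus `-x`. -/
theorem storage_value_sub_payment_le_of_nonpos {pim pip a b x e : ℝ} (ha : pim ≤ a) (hab : a ≤ b)
    (hb : b ≤ pip) (hx : x ≤ 0) :
    -(pip * max (x + e) 0 + pim * min (x + e) 0) + (a * max e 0 - b * max (-e) 0) ≤ -(a * x) := by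
  rcases le_total 0 e with he | he <;> rcases le_total 0 (x + e) with hz | hz <;>
    simp only [he, hz, max_eq_left, max_eq_right, min_eq_left, min_eq_right,
      Left.neg_nonpos_iff, Left.nonneg_neg_iff] <;> nlinarith

/-- A separable sum of concave functions is concave on the box. -/
theorem ConcaveOn.sum_pi {ι : Type*} [Fintype ι] {s : ι → Set ℝ} {u : ι → ℝ → ℝ}
    (hu : ∀ i, ConcaveOn ℝ (s i) (u i)) :
    ConcaveOn ℝ (univ.pi s) fun d : ι → ℝ => ∑ i, u i (d i) := by
  refine ⟨convex_pi fun i _ => (hu i).1, fun x hx y hy α β hα hβ hαβ => ?_⟩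
  simp only [smul_eq_mul, Finset.mul_sum, ← Finset.sum_add_distrib]
  exact Finset.sum_le_sum fun i _ =>
    (hu i).2 (hx i (mem_univ i)) (hy i (mem_univ i)) hα hβ hαβ

theorem optimal_policy_net_zero_idle_storage
    (K : ℕ) (hK : 0 < K)
    (dbar : Fin K → ℝ) (hdbar : ∀ k, 0 < dbar k)
    (U : Fin K → ℝ → ℝ)
    (hconc : ∀ k, StrictConcaveOn ℝ (Icc 0 (dbar k)) (U k))
    (hmono : ∀ k, MonotoneOn (U k) (Icc 0 (dbar k)))
    (hC1 : ∀ k, ContDiffOn ℝ 1 (U k) (Icc 0 (dbar k)))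
    -- NEM X rates
    (pim pip : ℝ) (hpim : 0 ≤ pim) (hpi : pim ≤ pip)
    (P : ℝ → ℝ) (hP : ∀ z, P z = pip * max z 0 + pim * min z 0)
    -- storage parameters
    (elow ebar : ℝ) (helow : 0 ≤ elow) (hebar : 0 ≤ ebar)
    (tau rho : ℝ) (htau : tau ∈ Ioc (0:ℝ) 1) (hrho : rho ∈ Ioc (0:ℝ) 1)
    (gam : ℝ) (hgam : 0 ≤ gam)
    -- strict A1
    (hA1m : pim < tau * gam) (hA1p : gam / rho < pip)
    -- consumption set
    (D : Set (Fin K → ℝ)) (hD : D = univ.pi fun k => Icc 0 (dbar k))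
    -- `f k π` is the unique maximizer of `x ↦ U k x − π x` over `[0, dbar k]`
    (f : Fin K → ℝ → ℝ)
    (hf : ∀ k, ∀ π : ℝ, 0 ≤ π → f k π ∈ Icc 0 (dbar k) ∧
      (∀ x ∈ Icc 0 (dbar k), x ≠ f k π → U k x - π * x < U k (f k π) - π * f k π))
    -- renewable generation
    (g : ℝ) (hg : 0 ≤ g)
    -- storage-adjusted stage surplus
    (J : (Fin K → ℝ) → ℝ → ℝ)
    (hJ : ∀ d e, J d e = (∑ k, U k (d k)) - P ((∑ k, d k) + e - g)
        + gam * (tau * max e 0 - max (-e) 0 / rho))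
    -- σ⁺ᵒ ≤ g ≤ σ⁻ᵒ, where σ⁺ᵒ = f(γ/ρ) and σ⁻ᵒ = f(τγ)
    (hzone₁ : (∑ k, f k (gam / rho)) ≤ g) (hzone₂ : g ≤ (∑ k, f k (tau * gam)))
    -- dstar maximizes U over D subject to Σ_k d_k = g
    (dstar : Fin K → ℝ) (hdstar : dstar ∈ D) (hsum : (∑ k, dstar k) = g)
    (hUmax : ∀ d ∈ D, (∑ k, d k) = g → (∑ k, U k (d k)) ≤ (∑ k, U k (dstar k))) :
    -- note σ⁺ᵒ ≤ σ⁻ᵒ since τγ ≤ γ/ρ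
    ((∑ k, f k (gam / rho)) ≤ (∑ k, f k (tau * gam))) ∧
    ((0:ℝ) ∈ Icc (-elow) ebar) ∧
    (∀ d ∈ D, ∀ e ∈ Icc (-elow) ebar, J d e ≤ J dstar 0) := by
  have ha0 : 0 ≤ tau * gam := mul_nonneg htau.1.le hgam
  have hb0 : 0 ≤ gam / rho := div_nonneg hgam hrho.1.le
  have hab : tau * gam ≤ gam / rho :=
    (mul_le_of_le_one_left hgam htau.2).trans (le_div_self hgam hrho.1 hrho.2)
  refine ⟨Finset.sum_le_sum fun k _ => priceResponse_antitone hab (hf k _ ha0).1 (hf k _ hb0).1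
    (hf k _ ha0).2 (hf k _ hb0).2, ⟨by linarith, hebar⟩, ?_⟩
  subst hD
  intro d hd e _
  have hbound : ∀ c, 0 ≤ c → g ∈ segment ℝ (∑ k, f k c) (∑ k, d k) →
      (∑ k, U k (d k)) - c * ((∑ k, d k) - g) ≤ ∑ k, U k (dstar k) := by
    intro c hc hseg
    let L : (Fin K → ℝ) →ₗ[ℝ] ℝ := ∑ k, LinearMap.proj k
    have hL : ∀ x, L x = ∑ k, x k := fun x => by simp [L]
    have hmax : (∑ k, U k (d k)) - c * L d ≤ (∑ k, U k (f k c)) - c * L fun k => f k c := by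
      simp only [hL, Finset.mul_sum, ← Finset.sum_sub_distrib]
      refine Finset.sum_le_sum fun k _ => ?_
      rcases eq_or_ne (d k) (f k c) with h | h
      · rw [h]
      · exact ((hf k c hc).2 _ (hd k (mem_univ k)) h).le
    obtain ⟨x, hx, hxg, hle⟩ :=
      (ConcaveOn.sum_pi fun k => (hconc k).concaveOn).exists_eq_of_penalized_max L
        (p := fun k => f k c) (fun k _ => (hf k c hc).1) hd hmax (by simpa only [hL] using hseg)
    rw [hL] at hxg hle
    exact hle.trans (hUmax x hx hxg)
  have hJstar : J dstar 0 = ∑ k, U k (dstar k) := by simp [hJ, hP, hsum]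
  have hJd : J d e = (∑ k, U k (d k)) +
      (-(pip * max ((∑ k, d k) - g + e) 0 + pim * min ((∑ k, d k) - g + e) 0) +
        (tau * gam * max e 0 - gam / rho * max (-e) 0)) := by
    rw [hJ, hP, add_sub_right_comm]
    ring
  rw [hJstar, hJd]
  rcases le_total g (∑ k, d k) with h | h
  · have h1 := storage_value_sub_payment_le_of_nonneg (e := e) hA1m.le hab hA1p.le (sub_nonneg.2 h)
    have h2 := hbound _ hb0 (by rw [segment_eq_uIcc]; exact mem_uIcc_of_le hzone₁ h)
    linarith
  · have h1 := storage_value_sub_payment_le_of_nonpos (e := e) hA1m.le hab hA1p.le (sub_nonpos.2 h)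
    have h2 := hbound _ ha0 (by rw [segment_eq_uIcc]; exact mem_uIcc_of_ge h hzone₂)
    linarith
end

section
/- (Optimal policy, net-zero zone, maximum-charge segment.) Under strict A1, if σ⁻ ≤ g ≤ Δ⁻, where σ⁻ := f(τγ) + ē and Δ⁻ := f(π⁻) + ē, then the pair (d*, e*) with e* = ē and d* the maximizer of U(d) over D subject to Σ_k d_k = g − ē maximizes J over D × [−e̲, ē]; in particular the net consumption is zero and the storage charges at its maximum rate. -/
open Set

open Filter Topology in
/-- The unique maximizer of `y ↦ u y - x * y` over a compact set depends continuously on `x`. -/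
theorem continuousOn_maximizer_sub_mul {s T : Set ℝ} (hs : IsCompact s) {u h : ℝ → ℝ}
    (hu : ContinuousOn u s)
    (hh : ∀ x ∈ T, h x ∈ s ∧ ∀ y ∈ s, y ≠ h x → u y - x * y < u (h x) - x * h x) :
    ContinuousOn h T := by
  intro x hx
  refine hs.tendsto_nhds_of_unique_mapClusterPt
    (eventually_mem_nhdsWithin.mono fun p hp => (hh p hp).1) fun y hy hcl => ?_
  by_contra hne
  have hlt := (hh x hx).2 y hy hne
  have huy : Tendsto u (𝓝[s] y) (𝓝 (u y)) := hu y hy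
  have hp : Tendsto (fun q : ℝ × ℝ => q.1) (𝓝[T] x ×ˢ 𝓝[s] y) (𝓝 x) :=
    tendsto_fst.mono_right nhdsWithin_le_nhds
  have hz : Tendsto (fun q : ℝ × ℝ => q.2) (𝓝[T] x ×ˢ 𝓝[s] y) (𝓝 y) :=
    tendsto_snd.mono_right nhdsWithin_le_nhds
  have hev := ((huy.comp tendsto_snd).sub (hp.mul hz)).eventually_lt
    (tendsto_const_nhds.sub (hp.mul_const (h x))) hlt
  obtain ⟨A, hA, B, hB, hAB⟩ := eventually_prod_iff.1 hev
  obtain ⟨p, hpB, hpA, hpT⟩ := ((hcl.frequently (eventually_nhdsWithin_iff.1 hB)).and_eventually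
    (hA.and eventually_mem_nhdsWithin)).exists
  have hcontra := hAB hpA (hpB (hh p hpT).1)
  rcases eq_or_ne (h x) (h p) with heq | hne'
  · simp [heq] at hcontra
  · exact lt_asymm hcontra ((hh p hpT).2 _ (hh x hx).1 hne')

/-- The storage value is dominated by its charging slope, as discharging is priced higher. -/
theorem storage_value_le {gam tau rho : ℝ} (hgam : 0 ≤ gam) (htau : tau ≤ 1)
    (hrho : rho ∈ Ioc (0 : ℝ) 1) (e : ℝ) :
    gam * (tau * max e 0 - max (-e) 0 / rho) ≤ tau * gam * e := by
  have hdiv : max (-e) 0 ≤ max (-e) 0 / rho := le_div_self (le_max_right _ _) hrho.1 hrho.2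
  have hmul : tau * max (-e) 0 ≤ max (-e) 0 := mul_le_of_le_one_left (le_max_right _ _) htau
  have he : e = max e 0 - max (-e) 0 := by
    rcases le_total e 0 with h | h <;> simp [h]
  calc gam * (tau * max e 0 - max (-e) 0 / rho)
      ≤ gam * (tau * max e 0 - tau * max (-e) 0) := by gcongr; linarith
    _ = tau * gam * (max e 0 - max (-e) 0) := by ring
    _ = tau * gam * e := by rw [← he]

/-- A net-metering payment dominates every linear tariff with a rate between the two prices. -/
theorem mul_le_net_metering_payment {a b μ : ℝ} (ha : a ≤ μ) (hb : μ ≤ b) (z : ℝ) :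
    μ * z ≤ b * max z 0 + a * min z 0 := by
  rcases le_total z 0 with h | h
  · simpa [h] using mul_le_mul_of_nonpos_right ha h
  · simpa [h] using mul_le_mul_of_nonneg_right hb h

theorem optimal_policy_net_zero_max_charge
    (K : ℕ) (hK : 0 < K)
    (dbar : Fin K → ℝ) (hdbar : ∀ k, 0 < dbar k)
    (U : Fin K → ℝ → ℝ)
    (hconc : ∀ k, StrictConcaveOn ℝ (Icc 0 (dbar k)) (U k))
    (hmono : ∀ k, MonotoneOn (U k) (Icc 0 (dbar k)))
    (hC1 : ∀ k, ContDiffOn ℝ 1 (U k) (Icc 0 (dbar k)))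
    -- NEM X rates
    (pim pip : ℝ) (hpim : 0 ≤ pim) (hpi : pim ≤ pip)
    (P : ℝ → ℝ) (hP : ∀ z, P z = pip * max z 0 + pim * min z 0)
    -- storage parameters
    (elow ebar : ℝ) (helow : 0 ≤ elow) (hebar : 0 ≤ ebar)
    (tau rho : ℝ) (htau : tau ∈ Ioc (0:ℝ) 1) (hrho : rho ∈ Ioc (0:ℝ) 1)
    (gam : ℝ) (hgam : 0 ≤ gam)
    -- strict A1
    (hA1m : pim < tau * gam) (hA1p : gam / rho < pip)
    -- consumption set
    (D : Set (Fin K → ℝ)) (hD : D = univ.pi fun k => Icc 0 (dbar k))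
    -- `f k π` is the unique maximizer of `x ↦ U k x − π x` over `[0, dbar k]`
    (f : Fin K → ℝ → ℝ)
    (hf : ∀ k, ∀ π : ℝ, 0 ≤ π → f k π ∈ Icc 0 (dbar k) ∧
      (∀ x ∈ Icc 0 (dbar k), x ≠ f k π → U k x - π * x < U k (f k π) - π * f k π))
    -- renewable generation
    (g : ℝ) (hg : 0 ≤ g)
    -- storage-adjusted stage surplus
    (J : (Fin K → ℝ) → ℝ → ℝ)
    (hJ : ∀ d e, J d e = (∑ k, U k (d k)) - P ((∑ k, d k) + e - g)
        + gam * (tau * max e 0 - max (-e) 0 / rho))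
    -- σ⁻ ≤ g ≤ Δ⁻, where σ⁻ = f(τγ) + ē and Δ⁻ = f(π⁻) + ē
    (hzone₁ : (∑ k, f k (tau * gam)) + ebar ≤ g) (hzone₂ : g ≤ (∑ k, f k pim) + ebar)
    -- dstar maximizes U over D subject to Σ_k d_k = g − ē
    (dstar : Fin K → ℝ) (hdstar : dstar ∈ D) (hsum : (∑ k, dstar k) = g - ebar)
    (hUmax : ∀ d ∈ D, (∑ k, d k) = g - ebar →
      (∑ k, U k (d k)) ≤ (∑ k, U k (dstar k))) :
    (ebar ∈ Icc (-elow) ebar) ∧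
    (∀ d ∈ D, ∀ e ∈ Icc (-elow) ebar, J d e ≤ J dstar ebar) ∧
    (∑ k, dstar k) + ebar - g = 0 := by
  subst hD
  have hcont : ContinuousOn (fun π => ∑ k, f k π) (Icc pim (tau * gam)) :=
    continuousOn_finsetSum _ fun k _ => continuousOn_maximizer_sub_mul isCompact_Icc
      (hC1 k).continuousOn fun π hπ => hf k π (hpim.trans hπ.1)
  obtain ⟨μ, ⟨hμ₁, hμ₂⟩, hμ⟩ := intermediate_value_Icc' hA1m.le hcont
    (show g - ebar ∈ Icc _ _ from ⟨by linarith, by linarith⟩)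
  replace hμ : ∑ k, f k μ = g - ebar := hμ
  have hfμ := fun k => hf k μ (hpim.trans hμ₁)
  have hμpip : μ ≤ pip := by
    have h₁ : tau * gam ≤ gam := mul_le_of_le_one_left hgam htau.2
    have h₂ : gam ≤ gam / rho := le_div_self hgam hrho.1 hrho.2
    linarith
  have hlag : ∀ d ∈ univ.pi fun k => Icc 0 (dbar k),
      ∑ k, U k (d k) - μ * ∑ k, d k ≤ ∑ k, U k (dstar k) - μ * (g - ebar) := by
    intro d hd
    have hle : ∑ k, (U k (d k) - μ * d k) ≤ ∑ k, (U k (f k μ) - μ * f k μ) := by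
      refine Finset.sum_le_sum fun k _ => ?_
      rcases eq_or_ne (d k) (f k μ) with h | h
      · rw [h]
      · exact ((hfμ k).2 _ (hd k trivial) h).le
    simp only [Finset.sum_sub_distrib, ← Finset.mul_sum, hμ] at hle
    have hopt := hUmax (fun k => f k μ) (fun k _ => (hfμ k).1) hμ
    linarith
  have hzero : ∑ k, dstar k + ebar - g = 0 := by rw [hsum]; ring
  refine ⟨⟨by linarith, le_rfl⟩, fun d hd e he => ?_, hzero⟩
  have hstar : J dstar ebar = ∑ k, U k (dstar k) + tau * gam * ebar := by
    rw [hJ, hP, hzero, max_eq_left hebar, max_eq_right (neg_nonpos.2 hebar)]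
    simp only [max_self, min_self]
    ring
  have hpay := mul_le_net_metering_payment hμ₁ hμpip (∑ k, d k + e - g)
  have hstor := storage_value_le hgam htau.2 hrho e
  have hcharge := mul_le_mul_of_nonneg_left he.2 (sub_nonneg.2 hμ₂)
  rw [hstar, hJ, hP]
  linarith [hlag d hd]
end

section
/- (Optimal storage operation of a passive prosumer minimizes the magnitude of net consumption.) Fix the consumption at the passive level d̂ ≥ 0 (the DG-passive total consumption, e.g., d̂ = f(π⁺)) and let g ≥ 0. Under strict A1, every maximizer e* of h(e) := −P(d̂ + e − g) + γ·(τ·max(e,0) − max(−e,0)/ρ) over e ∈ [−e̲, ē] satisfies |d̂ + e* − g| ≤ |d̂ + e − g| for every e ∈ [−e̲, ē]; i.e., the optimal storage operation discharges/charges as much as possible to minimize the absolute value of the net consumption. -/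
open Set

/-- Increments of a two-slope concave piecewise linear function lie between those of its slopes. -/
lemma two_slope_increment_mem_Icc {a c x y : ℝ} (hac : a ≤ c) (hxy : x ≤ y) :
    (a * max y 0 - c * max (-y) 0) - (a * max x 0 - c * max (-x) 0) ∈
      Icc (a * (y - x)) (c * (y - x)) := by
  rcases le_total 0 x with hx | hx <;> rcases le_total 0 y with hy | hy <;>
    simp only [max_eq_left, max_eq_right, neg_nonneg, neg_nonpos, hx, hy, mem_Icc] <;>
    constructor <;> nlinarith

theorem passive_prosumer_minimizes_abs_net_consumption
    -- NEM X rates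
    (pim pip : ℝ) (hpim : 0 ≤ pim) (hpi : pim ≤ pip)
    (P : ℝ → ℝ) (hP : ∀ z, P z = pip * max z 0 + pim * min z 0)
    -- storage parameters
    (elow ebar : ℝ) (helow : 0 ≤ elow) (hebar : 0 ≤ ebar)
    (tau rho : ℝ) (htau : tau ∈ Ioc (0:ℝ) 1) (hrho : rho ∈ Ioc (0:ℝ) 1)
    (gam : ℝ) (hgam : 0 ≤ gam)
    -- strict A1
    (hA1m : pim < tau * gam) (hA1p : gam / rho < pip)
    -- fixed (DG-passive) total consumption and renewable generation
    (dhat g : ℝ) (hdhat : 0 ≤ dhat) (hg : 0 ≤ g)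
    -- storage-adjusted stage objective at the passive consumption level
    (h : ℝ → ℝ)
    (hh : ∀ e, h e = -P (dhat + e - g) + gam * (tau * max e 0 - max (-e) 0 / rho))
    -- estar is a maximizer of h over [−e̲, ē]
    (estar : ℝ) (hestar : estar ∈ Icc (-elow) ebar)
    (hmax : IsMaxOn h (Icc (-elow) ebar) estar) :
    ∀ e ∈ Icc (-elow) ebar, |dhat + estar - g| ≤ |dhat + e - g| := by
  have hslope : tau * gam ≤ gam / rho :=
    (mul_le_of_le_one_left hgam htau.2).trans (le_div_self hgam hrho.1 hrho.2)
  have hform : ∀ e, h e = -(pip * max (dhat + e - g) 0 + pim * min (dhat + e - g) 0) +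
      (tau * gam * max e 0 - gam / rho * max (-e) 0) := by
    intro e
    rw [hh, hP]
    ring
  -- `h` is strictly decreasing where net consumption is nonnegative
  have hdecr : ∀ x y, 0 ≤ dhat + x - g → x < y → h y < h x := by
    intro x y hx hxy
    have hV := (two_slope_increment_mem_Icc hslope hxy.le).2
    have hy : 0 ≤ dhat + y - g := by linarith
    rw [hform, hform, max_eq_left hx, max_eq_left hy, min_eq_right hx, min_eq_right hy]
    nlinarith [mul_pos (sub_pos.2 hA1p) (sub_pos.2 hxy)]
  -- and strictly increasing where it is nonpositive
  have hincr : ∀ x y, dhat + y - g ≤ 0 → x < y → h x < h y := by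
    intro x y hy hxy
    have hV := (two_slope_increment_mem_Icc hslope hxy.le).1
    have hx : dhat + x - g ≤ 0 := by linarith
    rw [hform, hform, max_eq_right hx, max_eq_right hy, min_eq_left hx, min_eq_left hy]
    nlinarith [mul_pos (sub_pos.2 hA1m) (sub_pos.2 hxy)]
  intro e he
  by_contra! hlt
  rcases le_total 0 (dhat + estar - g) with hs | hs
  · rw [abs_of_nonneg hs, abs_lt] at hlt
    have hlt' : max e (g - dhat) < estar := max_lt (by linarith) (by linarith)
    have hmem : max e (g - dhat) ∈ Icc (-elow) ebar :=
      ⟨he.1.trans (le_max_left _ _), hlt'.le.trans hestar.2⟩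
    exact (hdecr _ _ (by linarith [le_max_right e (g - dhat)]) hlt').not_ge (hmax hmem)
  · rw [abs_of_nonpos hs, abs_lt] at hlt
    have hlt' : estar < min e (g - dhat) := lt_min (by linarith) (by linarith)
    have hmem : min e (g - dhat) ∈ Icc (-elow) ebar :=
      ⟨hestar.1.trans hlt'.le, (min_le_left _ _).trans he.2⟩
    exact (hincr _ _ (by linarith [min_le_right e (g - dhat)]) hlt').not_ge (hmax hmem)
end

section
/- (Myopic reduction of the Bellman equation.) For every stage t and every state (s,g) with s ≥ 0, g ≥ 0, the Bellman equation reduces to V_t(s,g) = ∫ V_{t+1}(s, g′) κ_t(g, dg′) + sup over (d,e) ∈ D × [−e̲, ē] of J_t(d,e;g), where J_t(d,e;g) := U_t(d) − P_t(Σ_k d_k + e − g) + γ·(τ·max(e,0) − max(−e,0)/ρ). In particular, the set of actions attaining the stage-t supremum depends only on g and not on the storage state s. -/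
open Set MeasureTheory ProbabilityTheory

/-- Adding a constant to a function bounded above on a nonempty set shifts its supremum. -/
theorem sSup_image_const_add {α : Type*} {S : Set α} (hS : S.Nonempty) {f h : α → ℝ} (c : ℝ)
    (hf : ∀ u, f u = c + h u) (hb : BddAbove (f '' S)) :
    sSup (f '' S) = c + sSup (h '' S) := by
  have hbh : BddAbove (h '' S) := by
    obtain ⟨M, hM⟩ := hb
    refine ⟨M - c, ?_⟩
    rintro _ ⟨u, hu, rfl⟩
    have := hM (mem_image_of_mem f hu)
    rw [hf] at this
    linarith
  have key := (OrderIso.addLeft c).map_csSup' (hS.image h) hbh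
  rw [image_image] at key
  simp only [OrderIso.addLeft_apply] at key
  rw [key]
  exact congrArg sSup (image_congr fun u _ => hf u)

/-- The integral of a function affine in a parameter, against a probability measure. -/
theorem integral_shift_of_affine {μ : Measure ℝ} [IsProbabilityMeasure μ] {W : ℝ → ℝ → ℝ}
    {c : ℝ} (hint : ∀ s, Integrable (W s) μ) (hW : ∀ s g, W s g = W 0 g + c * s) (s x : ℝ) :
    ∫ g, W (s + x) g ∂μ = (∫ g, W s g ∂μ) + c * x := by
  have h : W (s + x) = fun g => W s g + c * x := by
    funext g
    rw [hW (s + x) g, hW s g]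
    ring
  rw [h, integral_add (hint s) (integrable_const _)]
  simp

theorem bellman_myopic_reduction
    (T K : ℕ) (hK : 0 < K)
    (dbar : ℕ → Fin K → ℝ) (hdbar : ∀ t k, 0 < dbar t k)
    (U : ℕ → Fin K → ℝ → ℝ)
    (hconc : ∀ t k, StrictConcaveOn ℝ (Icc 0 (dbar t k)) (U t k))
    (hmono : ∀ t k, MonotoneOn (U t k) (Icc 0 (dbar t k)))
    (hC1 : ∀ t k, ContDiffOn ℝ 1 (U t k) (Icc 0 (dbar t k)))
    -- NEM X rates and payment functions
    (pim pip : ℕ → ℝ) (hpim : ∀ t, 0 ≤ pim t) (hpi : ∀ t, pim t ≤ pip t)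
    (P : ℕ → ℝ → ℝ) (hP : ∀ t z, P t z = pip t * max z 0 + pim t * min z 0)
    -- storage parameters
    (elow ebar : ℝ) (helow : 0 ≤ elow) (hebar : 0 ≤ ebar)
    (tau rho : ℝ) (htau : tau ∈ Ioc (0:ℝ) 1) (hrho : rho ∈ Ioc (0:ℝ) 1)
    (gam : ℝ) (hgam : 0 ≤ gam)
    -- feasible action set (state independent)
    (A : ℕ → Set ((Fin K → ℝ) × ℝ))
    (hA : ∀ t, A t = (univ.pi fun k => Icc 0 (dbar t k)) ×ˢ Icc (-elow) ebar)
    -- Markov transition kernels of the renewable process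
    (κ : ℕ → Kernel ℝ ℝ) (hκ : ∀ t, IsMarkovKernel (κ t))
    -- value functions, their measurability and integrability
    (V : ℕ → ℝ → ℝ → ℝ)
    (hVmeas : ∀ t s, Measurable (V t s))
    (hVint : ∀ t t' s g, Integrable (V t s) (κ t' g))
    -- terminal value
    (hVT : ∀ s g, V T s g = gam * s)
    -- Bellman objective and backward induction
    (Φ : ℕ → ℝ → ℝ → (Fin K → ℝ) × ℝ → ℝ)
    (hΦ : ∀ t s g u, Φ t s g u =
      (∑ k, U t k (u.1 k)) - P t ((∑ k, u.1 k) + u.2 - g)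
        + ∫ g', V (t + 1) (s + tau * max u.2 0 - max (-u.2) 0 / rho) g' ∂(κ t g))
    (hbdd : ∀ t < T, ∀ s g, BddAbove (Φ t s g '' A t))
    (hBellman : ∀ t < T, ∀ s g, V t s g = sSup (Φ t s g '' A t))
    -- storage-adjusted stage surplus
    (J : ℕ → ℝ → (Fin K → ℝ) × ℝ → ℝ)
    (hJ : ∀ t g u, J t g u =
      (∑ k, U t k (u.1 k)) - P t ((∑ k, u.1 k) + u.2 - g)
        + gam * (tau * max u.2 0 - max (-u.2) 0 / rho)) :
    ∀ t < T, ∀ g : ℝ, 0 ≤ g →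
      -- the Bellman equation reduces to a myopic stage optimization
      ((∀ s : ℝ, 0 ≤ s →
        V t s g = (∫ g', V (t + 1) s g' ∂(κ t g)) + sSup (J t g '' A t)) ∧
      -- the set of optimal actions does not depend on the storage state
      (∀ s₁ s₂ : ℝ, 0 ≤ s₁ → 0 ≤ s₂ →
        {u ∈ A t | ∀ v ∈ A t, Φ t s₁ g v ≤ Φ t s₁ g u} =
        {u ∈ A t | ∀ v ∈ A t, Φ t s₂ g v ≤ Φ t s₂ g u})) := by
  have hAne : ∀ t, (A t).Nonempty := fun t => by
    rw [hA]
    refine ⟨(fun _ => 0, 0), fun k _ => ⟨le_rfl, (hdbar t k).le⟩, ?_, hebar⟩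
    simpa using helow
  have hΦJ : ∀ t, (∀ s g, V (t + 1) s g = V (t + 1) 0 g + gam * s) →
      ∀ s g u, Φ t s g u = (∫ g', V (t + 1) s g' ∂(κ t g)) + J t g u := by
    intro t hV s g u
    have := hκ t
    rw [hΦ, hJ, add_sub_assoc s,
      integral_shift_of_affine (fun s => hVint (t + 1) t s g) hV]
    ring
  have hred : ∀ t < T, (∀ s g, V (t + 1) s g = V (t + 1) 0 g + gam * s) →
      ∀ s g, V t s g = (∫ g', V (t + 1) s g' ∂(κ t g)) + sSup (J t g '' A t) := by
    intro t ht hV s g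
    rw [hBellman t ht]
    exact sSup_image_const_add (hAne t) _ (hΦJ t hV s g) (hbdd t ht s g)
  have haff : ∀ t ≤ T, ∀ s g, V t s g = V t 0 g + gam * s := by
    intro t ht
    induction ht using Nat.decreasingInduction with
    | self => simp [hVT]
    | of_succ t ht ih =>
      intro s g
      have := hκ t
      have h := integral_shift_of_affine (fun s => hVint (t + 1) t s g) ih 0 s
      rw [zero_add] at h
      rw [hred t ht ih s g, hred t ht ih 0 g, h]
      ring
  intro t ht g _
  have hV := haff (t + 1) ht
  refine ⟨fun s _ => hred t ht hV s g, fun s₁ s₂ _ _ => ?_⟩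
  simp only [hΦJ t hV, add_le_add_iff_left]
end
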